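/- arXiv:2208.00058 — 2 statements merged into one kernel-verified Lean document; each statement's English description precedes it below -/
import Mathlib

section
/- Identify ℝ² with ℂ. Let ℓ > 0, let Ω_ℓ = ℝ × (−ℓ/2, ℓ/2) ⊂ ℂ, and let y₀ ∈ (−ℓ/2, ℓ/2). Define u : ℂ → ℂ by u(z) = (π/ℓ) tanh((π/2ℓ)(z + iy₀)) − (π/ℓ) coth((π/2ℓ)(conj(z) + iy₀)) + 2/(conj(z) + iy₀) for z ∈ Ω_ℓ \ {iy₀}, and u(z) = 2/(conj(z) + iy₀) for z ∈ ℂ \ Ω_ℓ. Then u extends to a continuous function on all of ℂ (the singularity at z = iy₀ is removable, as the coth pole cancels the pole of 2/(conj(z)+iy₀)), u is harmonic on Ω_ℓ, and ∫_{ℝ²} (|∇Re u|² + |∇Im u|²) dx = 4π³/(ℓ² cos²(πy₀/ℓ)). In particular, over all y₀ ∈ (−ℓ/2, ℓ/2) this Dirichlet energy is minimized at y₀ = 0, with value 4π³/ℓ². -/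
open MeasureTheory Real Complex

noncomputable section

/-- The Dirichlet energy `D(u) = ∫_{ℝ²} (|∇Re u|² + |∇Im u|²) dx` of a map
`u : ℂ → ℂ`, with `ℝ²` identified with `ℂ` (Lebesgue measure). -/
def dirE (u : ℂ → ℂ) : ℝ :=
  ∫ z : ℂ, (‖fderiv ℝ (fun w => (u w).re) z‖ ^ 2 + ‖fderiv ℝ (fun w => (u w).im) z‖ ^ 2)

/-- The complex hyperbolic cotangent, `coth w = cosh w / sinh w`. -/
def cothC (w : ℂ) : ℂ := Complex.cosh w / Complex.sinh w

/-- Harmonicity of `v : ℂ → ℂ` on a set: `v` is `C²` there and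
`∂₁₁ v + ∂₂₂ v = 0` (real Laplacian of both components vanishes). -/
def HarmOn (v : ℂ → ℂ) (s : Set ℂ) : Prop :=
  ContDiffOn ℝ 2 v s ∧
  ∀ z ∈ s, fderiv ℝ (fun w => fderiv ℝ v w 1) z 1
      + fderiv ℝ (fun w => fderiv ℝ v w Complex.I) z Complex.I = 0

/-- The candidate minimizer for the strip `Ω_ℓ = ℝ × (−ℓ/2, ℓ/2)`:
`u(z) = (π/ℓ)tanh((π/2ℓ)(z+iy₀)) − (π/ℓ)coth((π/2ℓ)(conj z+iy₀)) + 2/(conj z+iy₀)`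
inside the strip, and `2/(conj z + iy₀)` outside. -/
def stripU (ℓ y₀ : ℝ) (z : ℂ) : ℂ :=
  if -ℓ / 2 < z.im ∧ z.im < ℓ / 2 then
    ((π / ℓ : ℝ) : ℂ) * Complex.tanh (((π / (2 * ℓ) : ℝ) : ℂ) * (z + Complex.I * (y₀ : ℂ)))
      - ((π / ℓ : ℝ) : ℂ) * cothC (((π / (2 * ℓ) : ℝ) : ℂ)
          * (starRingEnd ℂ z + Complex.I * (y₀ : ℂ)))
      + 2 / (starRingEnd ℂ z + Complex.I * (y₀ : ℂ))
  else 2 / (starRingEnd ℂ z + Complex.I * (y₀ : ℂ))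

/-- The real-linear map `h ↦ α h + conj (β h)`. -/
def linAB (α β : ℂ) : ℂ →L[ℝ] ℂ :=
  ContinuousLinearMap.mul ℝ ℂ α
    + (Complex.conjCLE : ℂ →L[ℝ] ℂ).comp (ContinuousLinearMap.mul ℝ ℂ β)

lemma linAB_apply (α β h : ℂ) : linAB α β h = α * h + (starRingEnd ℂ) (β * h) := by
  simp [linAB]

lemma hasFDerivAt_real_of_deriv {f : ℂ → ℂ} {α z : ℂ} (hf : HasDerivAt f α z) :
    HasFDerivAt f (ContinuousLinearMap.mul ℝ ℂ α) z := by
  have h := hf.hasFDerivAt.restrictScalars ℝ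
  have e : ContinuousLinearMap.mul ℝ ℂ α
      = ContinuousLinearMap.restrictScalars ℝ (ContinuousLinearMap.toSpanSingleton ℂ α) := by
    ext x
    simp [mul_comm]
  rw [e]
  exact h

lemma hasFDerivAt_conj {f : ℂ → ℂ} {α z : ℂ} (hf : HasDerivAt f α z) :
    HasFDerivAt (fun w => (starRingEnd ℂ) (f w))
      ((Complex.conjCLE : ℂ →L[ℝ] ℂ).comp (ContinuousLinearMap.mul ℝ ℂ α)) z :=
  (Complex.conjCLE : ℂ →L[ℝ] ℂ).hasFDerivAt.comp z (hasFDerivAt_real_of_deriv hf)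

lemma hasFDerivAt_AB {f G : ℂ → ℂ} {α β z : ℂ} (hf : HasDerivAt f α z) (hG : HasDerivAt G β z) :
    HasFDerivAt (fun w => f w + (starRingEnd ℂ) (G w)) (linAB α β) z :=
  (hasFDerivAt_real_of_deriv hf).add (hasFDerivAt_conj hG)

lemma norm_re_mul (L : ℂ →L[ℝ] ℝ) (α : ℂ) (h : ∀ w, L w = (α * w).re) : ‖L‖ = ‖α‖ := by
  apply le_antisymm
  · refine L.opNorm_le_bound (norm_nonneg _) fun w => ?_
    rw [h, Real.norm_eq_abs, ← norm_mul]
    exact Complex.abs_re_le_norm _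
  · by_cases hα : α = 0
    · simp [hα]
    have h1 := L.le_opNorm ((starRingEnd ℂ) α)
    rw [h, Complex.mul_conj, Complex.ofReal_re, Complex.normSq_eq_norm_sq, Complex.norm_conj,
      Real.norm_eq_abs, abs_of_nonneg (by positivity), sq] at h1
    exact le_of_mul_le_mul_right h1 (norm_pos_iff.mpr hα)

/-- Energy density of `f + conj G`. -/
lemma density_AB {u : ℂ → ℂ} {α β z : ℂ} (hu : HasFDerivAt u (linAB α β) z) :
    ‖fderiv ℝ (fun w => (u w).re) z‖ ^ 2 + ‖fderiv ℝ (fun w => (u w).im) z‖ ^ 2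
      = 2 * ‖α‖ ^ 2 + 2 * ‖β‖ ^ 2 := by
  have h1 : HasFDerivAt (fun w => (u w).re) (Complex.reCLM.comp (linAB α β)) z :=
    Complex.reCLM.hasFDerivAt.comp z hu
  have h2 : HasFDerivAt (fun w => (u w).im) (Complex.imCLM.comp (linAB α β)) z :=
    Complex.imCLM.hasFDerivAt.comp z hu
  rw [h1.fderiv, h2.fderiv, norm_re_mul _ (α + β), norm_re_mul _ (-Complex.I * (α - β)), norm_mul]
  · simp only [← Complex.normSq_eq_norm_sq, norm_neg, Complex.norm_I, Complex.normSq_apply, one_mul,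
      Complex.add_re, Complex.add_im, Complex.sub_re, Complex.sub_im]
    ring
  · intro w
    simp [linAB_apply]
    ring
  · intro w
    simp [linAB_apply]
    ring

lemma harmOn_AB {u f G : ℂ → ℂ} {S : Set ℂ} (hS : IsOpen S) (hf : DifferentiableOn ℂ f S)
    (hG : DifferentiableOn ℂ G S) (hu : ∀ z ∈ S, u z = f z + (starRingEnd ℂ) (G z)) :
    HarmOn u S := by
  constructor
  · have h1 : ContDiffOn ℝ 2 f S := (hf.contDiffOn hS).restrict_scalars ℝ
    have h2 : ContDiffOn ℝ 2 G S := (hG.contDiffOn hS).restrict_scalars ℝ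
    have h3 : ContDiffOn ℝ 2 (fun z => f z + (starRingEnd ℂ) (G z)) S :=
      h1.add ((Complex.conjCLE : ℂ →L[ℝ] ℂ).contDiff.comp_contDiffOn h2)
    exact h3.congr hu
  · intro z hz
    have hd : ∀ w ∈ S, fderiv ℝ u w = linAB (deriv f w) (deriv G w) := by
      intro w hw
      have hn : S ∈ nhds w := hS.mem_nhds hw
      have := hasFDerivAt_AB (hf.differentiableAt hn).hasDerivAt (hG.differentiableAt hn).hasDerivAt
      refine (this.congr_of_eventuallyEq ?_).fderiv
      filter_upwards [hn] with x hx using hu x hx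
    have hn : S ∈ nhds z := hS.mem_nhds hz
    have hf' := ((hf.deriv hS).differentiableAt hn).hasDerivAt
    have hG' := ((hG.deriv hS).differentiableAt hn).hasDerivAt
    have key : ∀ h : ℂ, fderiv ℝ (fun w => fderiv ℝ u w h) z h
        = deriv (deriv f) z * h * h + (starRingEnd ℂ) (deriv (deriv G) z * h * h) := by
      intro h
      have h1 := hasFDerivAt_AB (hf'.mul_const h) (hG'.mul_const h)
      have h2 : HasFDerivAt (fun w => fderiv ℝ u w h)
          (linAB (deriv (deriv f) z * h) (deriv (deriv G) z * h)) z := by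
        refine h1.congr_of_eventuallyEq ?_
        filter_upwards [hn] with x hx
        rw [hd x hx, linAB_apply]
      rw [h2.fderiv, linAB_apply]
    rw [key, key]
    have : ∀ x : ℂ, x * Complex.I * Complex.I = -x := by
      intro x
      rw [mul_assoc, Complex.I_mul_I]
      ring
    rw [this, this]
    simp only [mul_one, map_neg]
    ring

lemma hasDerivAt_arctan_line {h : ℝ} (hh : 0 < h) (x : ℝ) :
    HasDerivAt (fun x => Real.arctan (x / h)) (h / (x ^ 2 + h ^ 2)) x := by
  have h1 := ((hasDerivAt_id x).div_const h).arctan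
  refine h1.congr_deriv ?_
  have : x ^ 2 + h ^ 2 ≠ 0 := by positivity
  have : h ^ 2 + x ^ 2 ≠ 0 := by positivity
  simp only [id]
  field_simp
  ring

lemma hasDerivAt_line2 {h : ℝ} (hh : 0 < h) (x : ℝ) :
    HasDerivAt (fun x => x / (2 * h ^ 2 * (x ^ 2 + h ^ 2)) + Real.arctan (x / h) / (2 * h ^ 3))
      (1 / (x ^ 2 + h ^ 2) ^ 2) x := by
  have hx : x ^ 2 + h ^ 2 ≠ 0 := by positivity
  have h0 : HasDerivAt (fun x : ℝ => 2 * h ^ 2 * (x ^ 2 + h ^ 2)) (2 * h ^ 2 * (2 * x)) x := by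
    simpa using (((hasDerivAt_id x).pow 2).add_const (h ^ 2)).const_mul (2 * h ^ 2)
  have h1 := ((hasDerivAt_id x).div h0 (by positivity)).add
    ((hasDerivAt_arctan_line hh x).div_const (2 * h ^ 3))
  refine h1.congr_deriv ?_
  simp only [id]
  field_simp
  ring

lemma tendsto_arctan_line {h : ℝ} (hh : 0 < h) :
    Filter.Tendsto (fun x => Real.arctan (x / h)) Filter.atTop (nhds (π / 2)) :=
  (Real.tendsto_arctan_atTop.mono_right nhdsWithin_le_nhds).comp
    (Filter.tendsto_id.atTop_div_const hh)

lemma tendsto_rat_line {h : ℝ} (hh : 0 < h) :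
    Filter.Tendsto (fun x : ℝ => x / (2 * h ^ 2 * (x ^ 2 + h ^ 2))) Filter.atTop (nhds 0) := by
  have h1 : Filter.Tendsto (fun x : ℝ => (1 / (2 * h ^ 2)) * x⁻¹) Filter.atTop (nhds 0) := by
    have h2 := (tendsto_inv_atTop_zero (𝕜 := ℝ)).const_mul (1 / (2 * h ^ 2))
    rwa [mul_zero] at h2
  refine squeeze_zero' ?_ ?_ h1
  · filter_upwards [Filter.eventually_gt_atTop 0] with x hx
    positivity
  · filter_upwards [Filter.eventually_gt_atTop 0] with x hx
    rw [← one_div, div_mul_div_comm, div_le_div_iff₀ (by positivity) (by positivity)]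
    have : 0 < h ^ 2 * h ^ 2 := by positivity
    nlinarith

lemma tendsto_line2 {h : ℝ} (hh : 0 < h) :
    Filter.Tendsto
      (fun x => x / (2 * h ^ 2 * (x ^ 2 + h ^ 2)) + Real.arctan (x / h) / (2 * h ^ 3))
      Filter.atTop (nhds (π / (4 * h ^ 3))) := by
  have := (tendsto_rat_line hh).add ((tendsto_arctan_line hh).div_const (2 * h ^ 3))
  convert this using 2
  field_simp
  ring

lemma line_cont {h : ℝ} (hh : 0 < h) :
    Continuous (fun x : ℝ => 1 / (x ^ 2 + h ^ 2) ^ 2) := by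
  have : ∀ x : ℝ, (x ^ 2 + h ^ 2) ^ 2 ≠ 0 := fun x => by positivity
  fun_prop (disch := assumption)

lemma line_cont1 {h : ℝ} (hh : 0 < h) :
    Continuous (fun x : ℝ => h / (x ^ 2 + h ^ 2)) := by
  have : ∀ x : ℝ, (x ^ 2 + h ^ 2) ≠ 0 := fun x => by positivity
  fun_prop (disch := assumption)

lemma tendsto_int_line1 {h : ℝ} (hh : 0 < h) :
    Filter.Tendsto (fun N : ℝ => ∫ x in (-N)..N, h / (x ^ 2 + h ^ 2)) Filter.atTop
      (nhds π) := by
  have e : ∀ N : ℝ, ∫ x in (-N)..N, h / (x ^ 2 + h ^ 2) = 2 * Real.arctan (N / h) := by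
    intro N
    rw [intervalIntegral.integral_eq_sub_of_hasDerivAt (fun x _ => hasDerivAt_arctan_line hh x)
      ((line_cont1 hh).intervalIntegrable _ _), neg_div, Real.arctan_neg]
    ring
  simp_rw [e]
  convert (tendsto_arctan_line hh).const_mul 2 using 2
  ring

lemma tendsto_int_line2 {h : ℝ} (hh : 0 < h) :
    Filter.Tendsto (fun N : ℝ => ∫ x in (-N)..N, 1 / (x ^ 2 + h ^ 2) ^ 2) Filter.atTop
      (nhds (π / (2 * h ^ 3))) := by
  have e : ∀ N : ℝ, ∫ x in (-N)..N, 1 / (x ^ 2 + h ^ 2) ^ 2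
      = 2 * (N / (2 * h ^ 2 * (N ^ 2 + h ^ 2)) + Real.arctan (N / h) / (2 * h ^ 3)) := by
    intro N
    rw [intervalIntegral.integral_eq_sub_of_hasDerivAt (fun x _ => hasDerivAt_line2 hh x)
      ((line_cont hh).intervalIntegrable _ _), neg_div, neg_div, Real.arctan_neg]
    ring
  simp_rw [e]
  convert (tendsto_line2 hh).const_mul 2 using 2
  field_simp
  ring

lemma line_tendsto (c : ℝ) {h : ℝ} (hh : 0 < h) :
    Filter.Tendsto (fun N : ℝ => ∫ x in (-N)..N,
      (-(4 * c) * (h / (x ^ 2 + h ^ 2)) + 4 * h * (1 / (x ^ 2 + h ^ 2) ^ 2))) Filter.atTop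
      (nhds (-(4 * c) * π + 2 * π / h ^ 2)) := by
  have e : ∀ N : ℝ, ∫ x in (-N)..N,
      (-(4 * c) * (h / (x ^ 2 + h ^ 2)) + 4 * h * (1 / (x ^ 2 + h ^ 2) ^ 2))
      = -(4 * c) * (∫ x in (-N)..N, h / (x ^ 2 + h ^ 2))
        + 4 * h * ∫ x in (-N)..N, 1 / (x ^ 2 + h ^ 2) ^ 2 := by
    intro N
    rw [intervalIntegral.integral_add, intervalIntegral.integral_const_mul,
      intervalIntegral.integral_const_mul]
    · exact ((line_cont1 hh).const_mul _).intervalIntegrable _ _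
    · exact ((line_cont hh).const_mul _).intervalIntegrable _ _
  simp_rw [e]
  convert ((tendsto_int_line1 hh).const_mul (-(4 * c))).add
    ((tendsto_int_line2 hh).const_mul (4 * h)) using 2
  field_simp
  ring

lemma line_integrable {h : ℝ} (hh : 0 < h) :
    Integrable (fun x : ℝ => 1 / (x ^ 2 + h ^ 2) ^ 2) ∧
      ∫ x : ℝ, 1 / (x ^ 2 + h ^ 2) ^ 2 = π / (2 * h ^ 3) := by
  have hc : AECover (volume : Measure ℝ) Filter.atTop (fun N : ℝ => Set.Ioc (-N) N) :=
    aecover_Ioc Filter.tendsto_neg_atTop_atBot Filter.tendsto_id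
  have hi : ∀ N : ℝ, IntegrableOn (fun x : ℝ => 1 / (x ^ 2 + h ^ 2) ^ 2) (Set.Ioc (-N) N) := by
    intro N
    exact ((line_cont hh).integrableOn_Icc).mono_set Set.Ioc_subset_Icc_self
  have hn : ∀ᵐ x : ℝ, 0 ≤ 1 / (x ^ 2 + h ^ 2) ^ 2 := Filter.Eventually.of_forall fun x => by
    positivity
  have ht : Filter.Tendsto (fun N : ℝ => ∫ x in Set.Ioc (-N) N, 1 / (x ^ 2 + h ^ 2) ^ 2)
      Filter.atTop (nhds (π / (2 * h ^ 3))) := by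
    refine (tendsto_int_line2 hh).congr' ?_
    filter_upwards [Filter.eventually_ge_atTop 0] with N hN
    rw [intervalIntegral.integral_of_le (by linarith)]
  exact ⟨hc.integrable_of_integral_tendsto_of_nonneg_ae _ hi hn ht,
    hc.integral_eq_of_tendsto_of_nonneg_ae _ hn hi ht⟩

lemma cube_Ioi {h b : ℝ} (hb : b < h) :
    IntegrableOn (fun y : ℝ => 4 * π / |y - b| ^ 3) (Set.Ioi h) ∧
      ∫ y in Set.Ioi h, 4 * π / |y - b| ^ 3 = 2 * π / (h - b) ^ 2 := by
  have hd : ∀ y ∈ Set.Ici h,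
      HasDerivAt (fun y : ℝ => -(2 * π) / (y - b) ^ 2) (4 * π / |y - b| ^ 3) y := by
    intro y hy
    have hy' : 0 < y - b := by
      have : h ≤ y := hy
      linarith
    have h0 : HasDerivAt (fun y : ℝ => (y - b) ^ 2) (2 * (y - b)) y := by
      have h2 := ((hasDerivAt_id y).sub_const b).pow 2
      simp only [id] at h2
      refine h2.congr_deriv ?_
      norm_num
    refine ((hasDerivAt_const y (-(2 * π))).div h0 (by positivity)).congr_deriv ?_
    rw [abs_of_pos hy']
    field_simp
    ring
  have hp : ∀ y ∈ Set.Ioi h, 0 ≤ 4 * π / |y - b| ^ 3 := by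
    intro y _
    positivity
  have ht : Filter.Tendsto (fun y : ℝ => -(2 * π) / (y - b) ^ 2) Filter.atTop (nhds 0) := by
    refine Filter.Tendsto.const_div_atTop ?_ _
    exact (Filter.tendsto_pow_atTop (two_ne_zero)).comp
      (Filter.tendsto_atTop_add_const_right _ (-b) Filter.tendsto_id)
  refine ⟨integrableOn_Ioi_deriv_of_nonneg' hd hp ht, ?_⟩
  rw [integral_Ioi_of_hasDerivAt_of_nonneg' hd hp ht]
  ring

lemma cube_Iio {h b : ℝ} (hb : -h < b) :
    IntegrableOn (fun y : ℝ => 4 * π / |y - b| ^ 3) (Set.Iic (-h)) ∧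
      ∫ y in Set.Iic (-h), 4 * π / |y - b| ^ 3 = 2 * π / (h + b) ^ 2 := by
  obtain ⟨h1, h2⟩ := cube_Ioi (h := h) (b := -b) (by linarith)
  have e : ∀ y : ℝ, 4 * π / |y - -b| ^ 3 = 4 * π / |-y - b| ^ 3 := by
    intro y
    rw [← abs_neg]
    congr 3
    ring
  simp_rw [e] at h1 h2
  constructor
  · have h3 := (integrableOn_Ici_iff_integrableOn_Ioi).mpr h1
    have h4 := (Measure.measurePreserving_neg (volume : Measure ℝ)).integrableOn_comp_preimage
      (Homeomorph.neg ℝ).measurableEmbedding (f := fun y : ℝ => 4 * π / |y - b| ^ 3)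
      (s := Set.Iic (-h))
    have hs : (Neg.neg ⁻¹' Set.Iic (-h) : Set ℝ) = Set.Ici h := by
      ext x
      simp
    rw [hs] at h4
    exact h4.mp h3
  · rw [← integral_comp_neg_Ioi h (fun y : ℝ => 4 * π / |y - b| ^ 3), h2]
    ring

/-- The energy of `2 / conj (z - i b)` outside of the strip. -/
lemma outer_energy {H b : ℝ} (hb1 : -H < b) (hb2 : b < H) :
    IntegrableOn (fun z : ℂ => 8 / ‖z - Complex.I * (b : ℂ)‖ ^ 4)
        {z : ℂ | ¬ (-H < z.im ∧ z.im < H)} ∧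
      ∫ z in {z : ℂ | ¬ (-H < z.im ∧ z.im < H)}, 8 / ‖z - Complex.I * (b : ℂ)‖ ^ 4
        = 2 * π / (H - b) ^ 2 + 2 * π / (H + b) ^ 2 := by
  set T : Set ℝ := Set.Iic (-H) ∪ Set.Ici H with hT
  have hmT : MeasurableSet T := measurableSet_Iic.union measurableSet_Ici
  have hdis : Disjoint (Set.Iic (-H)) (Set.Ici H) := by
    rw [Set.disjoint_left]
    intro x hx hx'
    simp only [Set.mem_Iic, Set.mem_Ici] at hx hx'
    linarith
  obtain ⟨i1, e1⟩ := cube_Ioi hb2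
  rw [← integrableOn_Ici_iff_integrableOn_Ioi] at i1
  rw [← integral_Ici_eq_integral_Ioi] at e1
  obtain ⟨i2, e2⟩ := cube_Iio (h := H) hb1
  have hTi : IntegrableOn (fun y : ℝ => 4 * π / |y - b| ^ 3) T := i2.union i1
  have hTe : ∫ y in T, 4 * π / |y - b| ^ 3 = 2 * π / (H - b) ^ 2 + 2 * π / (H + b) ^ 2 := by
    rw [hT, setIntegral_union hdis measurableSet_Ici i2 i1, e1, e2]
    ring
  set φ : ℝ × ℝ → ℝ := fun q => 8 * (1 / (q.1 ^ 2 + |q.2 - b| ^ 2) ^ 2) with hφ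
  have hφm : Measurable φ := by
    rw [hφ]
    fun_prop
  have hsl : ∀ y ∈ T, Integrable (fun x : ℝ => φ (x, y)) ∧ ∫ x, φ (x, y) = 4 * π / |y - b| ^ 3 := by
    intro y hy
    have hpos : 0 < |y - b| := by
      apply abs_pos.mpr
      rcases hy with hy | hy <;> simp only [Set.mem_Iic, Set.mem_Ici] at hy
      · intro h; linarith
      · intro h; linarith
    obtain ⟨j1, j2⟩ := line_integrable hpos
    refine ⟨j1.const_mul 8, ?_⟩
    simp only [hφ]
    rw [integral_const_mul, j2]
    field_simp
    norm_num
  have hφ0 : ∀ q, 0 ≤ φ q := fun q => by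
    simp only [hφ]
    positivity
  have hprod : Integrable φ ((volume : Measure ℝ).prod (volume.restrict T)) := by
    rw [integrable_prod_iff' hφm.aestronglyMeasurable]
    constructor
    · rw [ae_restrict_iff' hmT]
      exact Filter.Eventually.of_forall fun y hy => (hsl y hy).1
    · refine hTi.congr_fun (fun y hy => ?_) hmT
      simp only [Real.norm_eq_abs, abs_of_nonneg (hφ0 _)]
      exact (hsl y hy).2.symm
  have hval : ∫ q, φ q ∂((volume : Measure ℝ).prod (volume.restrict T))
      = 2 * π / (H - b) ^ 2 + 2 * π / (H + b) ^ 2 := by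
    rw [integral_prod_symm _ hprod, ← hTe]
    exact setIntegral_congr_fun hmT fun y hy => (hsl y hy).2
  have hmeas : (volume : Measure ℝ).prod (volume.restrict T)
      = (volume : Measure (ℝ × ℝ)).restrict (Set.univ ×ˢ T) := by
    rw [Measure.volume_eq_prod, ← Measure.prod_restrict, Measure.restrict_univ]
  rw [hmeas] at hprod hval
  have hpt : ∀ z : ℂ, φ (Complex.measurableEquivRealProd z)
      = 8 / ‖z - Complex.I * (b : ℂ)‖ ^ 4 := by
    intro z
    have : ‖z - Complex.I * (b : ℂ)‖ ^ 2 = z.re ^ 2 + |z.im - b| ^ 2 := by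
      rw [← Complex.normSq_eq_norm_sq, Complex.normSq_apply, sq_abs]
      simp
      ring
    simp only [hφ, Complex.measurableEquivRealProd_apply]
    rw [← this]
    ring
  have hset : Complex.measurableEquivRealProd ⁻¹' (Set.univ ×ˢ T)
      = {z : ℂ | ¬ (-H < z.im ∧ z.im < H)} := by
    ext z
    simp only [hT, Set.mem_preimage, Complex.measurableEquivRealProd_apply, Set.mem_prod,
      Set.mem_univ, true_and, Set.mem_union, Set.mem_Iic, Set.mem_Ici, Set.mem_ofPred_eq,
      not_and_or, not_lt]
  have vp := Complex.volume_preserving_equiv_real_prod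
  have me := Complex.measurableEquivRealProd.measurableEmbedding
  have k1 := (vp.integrableOn_comp_preimage me (f := φ) (s := Set.univ ×ˢ T)).mpr hprod
  have k2 := vp.setIntegral_preimage_emb me φ (Set.univ ×ˢ T)
  have hco : (φ ∘ Complex.measurableEquivRealProd) = fun z : ℂ => 8 / ‖z - Complex.I * (b : ℂ)‖ ^ 4 :=
    funext hpt
  rw [hco, hset] at k1
  simp_rw [hpt] at k2
  rw [hset] at k2
  exact ⟨k1, k2.trans hval⟩

/-- Integral over a rectangle as an iterated integral. -/
lemma rect_integral {N H : ℝ} (hN : 0 ≤ N) (hH : 0 ≤ H) (φ : ℂ → ℝ)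
    (hφ : ContinuousOn φ (Set.Icc (-N) N ×ℂ Set.Icc (-H) H)) :
    IntegrableOn φ (Set.Icc (-N) N ×ℂ Set.Icc (-H) H) ∧
    ∫ z in Set.Icc (-N) N ×ℂ Set.Icc (-H) H, φ z
      = ∫ x in (-N)..N, ∫ y in (-H)..H, φ (x + y * Complex.I) := by
  have hcpt : IsCompact (Set.Icc (-N) N ×ℂ Set.Icc (-H) H) :=
    isCompact_Icc.reProdIm isCompact_Icc
  have hint : IntegrableOn φ (Set.Icc (-N) N ×ℂ Set.Icc (-H) H) :=
    hφ.integrableOn_compact hcpt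
  refine ⟨hint, ?_⟩
  have vp := Complex.volume_preserving_equiv_real_prod.symm
  have me := Complex.measurableEquivRealProd.symm.measurableEmbedding
  have hset : Complex.measurableEquivRealProd.symm ⁻¹' (Set.Icc (-N) N ×ℂ Set.Icc (-H) H)
      = Set.Icc (-N) N ×ˢ Set.Icc (-H) H := by
    ext q
    simp only [Set.mem_preimage, Complex.mem_reProdIm, Complex.measurableEquivRealProd_symm_apply,
      Set.mem_prod]
  have k1 := (vp.integrableOn_comp_preimage me (f := φ)).mpr hint
  have k2 := vp.setIntegral_preimage_emb me φ (Set.Icc (-N) N ×ℂ Set.Icc (-H) H)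
  rw [hset] at k1 k2
  rw [← k2, Measure.volume_eq_prod,
    setIntegral_prod (fun q => φ (Complex.measurableEquivRealProd.symm q)) k1,
    intervalIntegral.integral_of_le (by linarith), integral_Icc_eq_integral_Ioc]
  refine setIntegral_congr_fun measurableSet_Ioc fun x _ => ?_
  rw [intervalIntegral.integral_of_le (by linarith), integral_Icc_eq_integral_Ioc]
  refine setIntegral_congr_fun measurableSet_Ioc fun y _ => ?_
  simp only [Complex.measurableEquivRealProd_symm_apply, Complex.mk_eq_add_mul_I]

/-- Stokes on a rectangle for the sum of a holomorphic and an antiholomorphic map. -/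
lemma rect_stokes {U : Set ℂ} (hU : IsOpen U) {f G e : ℂ → ℂ} (hf : DifferentiableOn ℂ f U)
    (hG : DifferentiableOn ℂ G U) (he : DifferentiableOn ℂ e U) {N H : ℝ} (hN : 0 ≤ N) (hH : 0 ≤ H)
    (hsub : Set.Icc (-N) N ×ℂ Set.Icc (-H) H ⊆ U) (F : ℂ → ℂ)
    (hF : F = fun z => ((starRingEnd ℂ) (f z) + G z) * deriv f z
      + (f z + (starRingEnd ℂ) (G z)) * deriv G z - e z) :
    ((∫ x in (-N)..N, F (x + (-H : ℝ) * Complex.I)) - (∫ x in (-N)..N, F (x + (H : ℝ) * Complex.I)) +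
      Complex.I * (∫ y in (-H)..H, F ((N : ℝ) + y * Complex.I)) -
      Complex.I * (∫ y in (-H)..H, F ((-N : ℝ) + y * Complex.I))).im
      = ∫ z in Set.Icc (-N) N ×ℂ Set.Icc (-H) H, (2 * ‖deriv f z‖ ^ 2 + 2 * ‖deriv G z‖ ^ 2) := by
  have hder : ∀ z ∈ U, ∃ L : ℂ →L[ℝ] ℂ, HasFDerivAt F L z ∧
      Complex.I * L 1 - L Complex.I
        = ((2 * ‖deriv f z‖ ^ 2 + 2 * ‖deriv G z‖ ^ 2 : ℝ) : ℂ) * Complex.I := by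
    intro z hz
    have hn : U ∈ nhds z := hU.mem_nhds hz
    have f1 := (hf.differentiableAt hn).hasDerivAt
    have G1 := (hG.differentiableAt hn).hasDerivAt
    have f2 := ((hf.deriv hU).differentiableAt hn).hasDerivAt
    have G2 := ((hG.deriv hU).differentiableAt hn).hasDerivAt
    have e1 := (he.differentiableAt hn).hasDerivAt
    have d1 := (hasFDerivAt_AB G1 f1).mul (hasFDerivAt_real_of_deriv f2)
    have d2 := (hasFDerivAt_AB f1 G1).mul (hasFDerivAt_real_of_deriv G2)
    have d3 := (d1.add d2).sub (hasFDerivAt_real_of_deriv e1)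
    refine ⟨_, d3.congr_of_eventuallyEq (Filter.Eventually.of_forall fun w => ?_), ?_⟩
    · rw [hF]
      simp only [Pi.add_apply, Pi.sub_apply, Pi.mul_apply]
      ring
    · have n1 : ∀ w : ℂ, ((‖w‖ ^ 2 : ℝ) : ℂ) = w * (starRingEnd ℂ) w := by
        intro w
        rw [Complex.mul_conj, Complex.normSq_eq_norm_sq]
      rw [Complex.ofReal_add, Complex.ofReal_mul, Complex.ofReal_mul, n1, n1]
      simp only [add_apply, sub_apply,
        smul_apply, linAB_apply, ContinuousLinearMap.mul_apply', smul_eq_mul,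
        map_mul, map_one, Complex.conj_I, Complex.ofReal_ofNat]
      ring_nf
      try simp only [Complex.I_sq]
      try ring
  choose! F' hF' hF'' using hder
  have hcf : ContinuousOn (fun z => 2 * ‖deriv f z‖ ^ 2 + 2 * ‖deriv G z‖ ^ 2) U := by
    have h1 := (hf.deriv hU).continuousOn
    have h2 := (hG.deriv hU).continuousOn
    fun_prop
  have hr := rect_integral hN hH _ (hcf.mono hsub)
  have hst := Complex.integral_boundary_rect_of_continuousOn_of_hasFDerivAt_real F F'
    ⟨-N, -H⟩ ⟨N, H⟩
  simp only [Set.uIcc_of_le (by linarith : -N ≤ N), Set.uIcc_of_le (by linarith : -H ≤ H),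
    min_eq_left (by linarith : -N ≤ N), min_eq_left (by linarith : -H ≤ H),
    max_eq_right (by linarith : -N ≤ N), max_eq_right (by linarith : -H ≤ H), smul_eq_mul] at hst
  have hop : Set.Ioo (-N) N ×ℂ Set.Ioo (-H) H ⊆ Set.Icc (-N) N ×ℂ Set.Icc (-H) H := by
    intro z hz
    rw [Complex.mem_reProdIm] at hz ⊢
    exact ⟨Set.Ioo_subset_Icc_self hz.1, Set.Ioo_subset_Icc_self hz.2⟩
  have hms : MeasurableSet (Set.Icc (-N) N ×ℂ Set.Icc (-H) H) :=
    (isCompact_Icc.reProdIm isCompact_Icc).measurableSet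
  rw [hst, hr.2]
  · have h3 : (∫ x in (-N)..N, ∫ y in (-H)..H, (Complex.I * (F' (x + y * Complex.I)) 1
        - (F' (x + y * Complex.I)) Complex.I))
        = (((∫ x in (-N)..N, ∫ y in (-H)..H, (2 * ‖deriv f (x + y * Complex.I)‖ ^ 2
          + 2 * ‖deriv G (x + y * Complex.I)‖ ^ 2)) : ℝ) : ℂ) * Complex.I := by
      rw [← intervalIntegral.integral_ofReal, ← intervalIntegral.integral_mul_const]
      refine intervalIntegral.integral_congr fun x hx => ?_
      rw [← intervalIntegral.integral_ofReal, ← intervalIntegral.integral_mul_const]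
      refine intervalIntegral.integral_congr fun y hy => ?_
      rw [Set.uIcc_of_le (by linarith)] at hx hy
      apply hF''
      apply hsub
      rw [Complex.mem_reProdIm]
      simpa using ⟨hx, hy⟩
    rw [h3]
    simp
  · intro z hz
    exact (hF' z (hsub hz)).continuousAt.continuousWithinAt
  · intro z hz
    exact hF' z (hsub (hop hz))
  · have : IntegrableOn (fun z => ((2 * ‖deriv f z‖ ^ 2 + 2 * ‖deriv G z‖ ^ 2 : ℝ) : ℂ) * Complex.I)
        (Set.Icc (-N) N ×ℂ Set.Icc (-H) H) := hr.1.ofReal.mul_const _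
    refine this.congr_fun (fun z hz => (hF'' z (hsub hz)).symm) hms

lemma null_line (η : ℝ) : volume {z : ℂ | z.im = η} = 0 := by
  have vp := Complex.volume_preserving_equiv_real_prod
  have hs : Complex.measurableEquivRealProd ⁻¹' (Set.univ ×ˢ {η}) = {z : ℂ | z.im = η} := by
    ext z
    simp [Complex.measurableEquivRealProd_apply]
  rw [← hs, vp.measure_preimage_equiv, Measure.volume_eq_prod, Measure.prod_prod]
  simp

/-- The jump computation on the boundary lines. -/
lemma boundary_im {U : Set ℂ} (hU : IsOpen U) {f G : ℂ → ℂ} (hf : DifferentiableOn ℂ f U)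
    (hG : DifferentiableOn ℂ G U) {b c η : ℝ} (hη : η - b ≠ 0)
    (hsub : ∀ z : ℂ, z.im = η → z ∈ U)
    (hc : deriv f (Complex.I * b) = c)
    (hbd : ∀ z : ℂ, z.im = η → G z = 2 / (z - Complex.I * b) - (starRingEnd ℂ) (f z)) (x : ℝ) :
    ((fun z => ((starRingEnd ℂ) (f z) + G z) * deriv f z
      + (f z + (starRingEnd ℂ) (G z)) * deriv G z
      - 4 * dslope (deriv f) (Complex.I * b) z) (x + η * Complex.I)).im
    = -(4 * c) * ((η - b) / (x ^ 2 + (η - b) ^ 2))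
      + 4 * (η - b) * (1 / (x ^ 2 + (η - b) ^ 2) ^ 2) := by
  set z : ℂ := x + η * Complex.I with hz
  have hzim : ∀ t : ℝ, ((t : ℂ) + η * Complex.I).im = η := fun t => by simp
  have hzn : U ∈ nhds z := hU.mem_nhds (hsub z (hzim x))
  set d : ℂ := z - Complex.I * b with hd
  have hdre : d.re = x := by simp [hd, hz]
  have hdim : d.im = η - b := by simp [hd, hz]
  have hd0 : d ≠ 0 := by
    intro h
    apply hη
    rw [← hdim, h]
    rfl
  have hrel : deriv G z = -2 / d ^ 2 - (starRingEnd ℂ) (deriv f z) := by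
    have g1 : HasDerivAt (fun t : ℝ => G (t + η * Complex.I)) (deriv G z) x :=
      ((hG.differentiableAt hzn).hasDerivAt.comp_add_const (x : ℂ) (η * Complex.I)).comp_ofReal
    have f1 : HasDerivAt (fun t : ℝ => f (t + η * Complex.I)) (deriv f z) x :=
      ((hf.differentiableAt hzn).hasDerivAt.comp_add_const (x : ℂ) (η * Complex.I)).comp_ofReal
    have f2 : HasDerivAt (fun t : ℝ => (starRingEnd ℂ) (f (t + η * Complex.I)))
        ((starRingEnd ℂ) (deriv f z)) x :=
      (Complex.conjCLE : ℂ →L[ℝ] ℂ).hasFDerivAt.comp_hasDerivAt x f1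
    have w0 : HasDerivAt (fun w : ℂ => 2 / (w - Complex.I * b)) (-2 / d ^ 2) z := by
      have := (hasDerivAt_const z (2 : ℂ)).div ((hasDerivAt_id z).sub_const (Complex.I * b)) hd0
      refine this.congr_deriv ?_
      simp [hd]
    have w1 : HasDerivAt (fun t : ℝ => 2 / ((t + η * Complex.I : ℂ) - Complex.I * b))
        (-2 / d ^ 2) x := (w0.comp_add_const (x : ℂ) (η * Complex.I)).comp_ofReal
    have hcongr : (fun t : ℝ => G (t + η * Complex.I))
        = fun t : ℝ => 2 / ((t + η * Complex.I : ℂ) - Complex.I * b)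
          - (starRingEnd ℂ) (f (t + η * Complex.I)) := funext fun t => hbd _ (hzim t)
    rw [hcongr] at g1
    exact g1.unique (w1.sub f2)
  have hsl : dslope (deriv f) (Complex.I * b) z = (deriv f z - c) / d := by
    rw [dslope_of_ne _ (by rw [← sub_ne_zero]; exact hd0), slope_def_field, hc]
  have hGz : G z = 2 / d - (starRingEnd ℂ) (f z) := hbd z (hzim x)
  simp only
  rw [hsl, hrel, hGz]
  set n : ℝ := x ^ 2 + (η - b) ^ 2 with hn
  have hn0 : n ≠ 0 := by
    have : 0 < (η - b) ^ 2 := by positivity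
    positivity
  have hn0' : (n : ℂ) ≠ 0 := by exact_mod_cast hn0
  have hdd : d * (starRingEnd ℂ) d = n := by
    rw [Complex.mul_conj, Complex.normSq_apply, hdre, hdim, hn]
    congr 1
    ring
  have hcd0 : (starRingEnd ℂ) d ≠ 0 := by simpa using hd0
  set α := deriv f z
  have key : ((starRingEnd ℂ) (f z) + (2 / d - (starRingEnd ℂ) (f z))) * α
      + (f z + (starRingEnd ℂ) (2 / d - (starRingEnd ℂ) (f z)))
        * (-2 / d ^ 2 - (starRingEnd ℂ) α) - 4 * ((α - c) / d)
      = -(2 * α / d + (starRingEnd ℂ) (2 * α / d))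
        + (starRingEnd ℂ) d * ((4 * c / n - 4 / n ^ 2 : ℝ) : ℂ) := by
    push_cast
    rw [← hdd]
    simp only [map_sub, map_div₀, map_mul, Complex.conj_conj, map_ofNat]
    field_simp
    ring
  rw [key, Complex.add_conj]
  rw [Complex.add_im, Complex.neg_im, Complex.ofReal_im, Complex.im_mul_ofReal, Complex.conj_im,
    hdim]
  field_simp
  ring

lemma strip_energy {U : Set ℂ} (hU : IsOpen U) {f G : ℂ → ℂ} (hf : DifferentiableOn ℂ f U)
    (hG : DifferentiableOn ℂ G U) {H b c C : ℝ} (hb1 : -H < b) (hb2 : b < H)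
    (hsub : ∀ z : ℂ, -H ≤ z.im → z.im ≤ H → z ∈ U)
    (hc : deriv f (Complex.I * b) = c)
    (hbd : ∀ z : ℂ, z.im = H ∨ z.im = -H →
      G z = 2 / (z - Complex.I * b) - (starRingEnd ℂ) (f z))
    (hdec : ∀ z : ℂ, -H ≤ z.im → z.im ≤ H → 1 ≤ |z.re| →
      ‖f z‖ ≤ C ∧ ‖G z‖ ≤ C ∧ ‖deriv f z‖ ≤ C / |z.re| ∧ ‖deriv G z‖ ≤ C / |z.re|) :
    IntegrableOn (fun z => 2 * ‖deriv f z‖ ^ 2 + 2 * ‖deriv G z‖ ^ 2)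
      {z : ℂ | -H < z.im ∧ z.im < H} ∧
    ∫ z in {z : ℂ | -H < z.im ∧ z.im < H}, (2 * ‖deriv f z‖ ^ 2 + 2 * ‖deriv G z‖ ^ 2)
      = 8 * π * c - 2 * π / (H - b) ^ 2 - 2 * π / (H + b) ^ 2 := by
  have hH : 0 < H := by linarith
  have hpU : Complex.I * b ∈ U := hsub _ (by simpa using hb1.le) (by simpa using hb2.le)
  set e : ℂ → ℂ := fun z => 4 * dslope (deriv f) (Complex.I * b) z with he
  have hed : DifferentiableOn ℂ e U :=
    ((Complex.differentiableOn_dslope (hU.mem_nhds hpU)).mpr (hf.deriv hU)).const_mul 4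
  set F : ℂ → ℂ := fun z => ((starRingEnd ℂ) (f z) + G z) * deriv f z
      + (f z + (starRingEnd ℂ) (G z)) * deriv G z - e z with hF
  set φ : ℂ → ℝ := fun z => 2 * ‖deriv f z‖ ^ 2 + 2 * ‖deriv G z‖ ^ 2 with hφ
  have c1 := hf.continuousOn
  have c2 := hG.continuousOn
  have c3 := (hf.deriv hU).continuousOn
  have c4 := (hG.deriv hU).continuousOn
  have c5 := hed.continuousOn
  have c6 : ContinuousOn (fun z => (starRingEnd ℂ) (f z)) U :=
    Complex.continuous_conj.comp_continuousOn c1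
  have c7 : ContinuousOn (fun z => (starRingEnd ℂ) (G z)) U :=
    Complex.continuous_conj.comp_continuousOn c2
  have hFc : ContinuousOn F U := (((c6.add c2).mul c3).add ((c1.add c7).mul c4)).sub c5
  have hφc : ContinuousOn φ U := by
    rw [hφ]
    fun_prop
  have hrs : ∀ N : ℝ, Set.Icc (-N) N ×ℂ Set.Icc (-H) H ⊆ U := by
    intro N z hz
    rw [Complex.mem_reProdIm] at hz
    exact hsub z hz.2.1 hz.2.2
  -- line integrals
  have hline : ∀ η : ℝ, (η = H ∨ η = -H) → ∀ N : ℝ,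
      (∫ x in (-N)..N, F (x + η * Complex.I)).im = ∫ x in (-N)..N,
        (-(4 * c) * ((η - b) / (x ^ 2 + (η - b) ^ 2))
          + 4 * (η - b) * (1 / (x ^ 2 + (η - b) ^ 2) ^ 2)) := by
    intro η hη N
    have hηU : ∀ z : ℂ, z.im = η → z ∈ U := by
      intro z hz
      rcases hη with h | h
      · exact hsub z (by linarith) (by linarith)
      · exact hsub z (by linarith) (by linarith)
    have hcl : Continuous fun x : ℝ => F (x + η * Complex.I) := by
      refine hFc.comp_continuous (by fun_prop) fun x => hηU _ (by simp)
    have := Complex.imCLM.intervalIntegral_comp_comm (hcl.intervalIntegrable (μ := volume) (-N) N)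
    simp only [Complex.imCLM_apply] at this
    rw [← this]
    refine intervalIntegral.integral_congr fun x _ => ?_
    refine boundary_im hU hf hG ?_ hηU hc ?_ x
    · rcases hη with h | h
      · intro h'; linarith
      · intro h'; linarith
    · intro z hz
      apply hbd
      rw [hz]
      exact hη
  -- side integrals
  set B : ℝ := (4 * C ^ 2 + 4 * C + 4 * |c|) with hB
  have hside : ∀ z : ℂ, -H ≤ z.im → z.im ≤ H → 1 ≤ |z.re| → ‖F z‖ ≤ B / |z.re| := by
    intro z h1 h2 h3
    obtain ⟨k1, k2, k3, k4⟩ := hdec z h1 h2 h3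
    have hC : 0 ≤ C := (norm_nonneg _).trans k1
    have hr : 0 < |z.re| := by linarith
    have hdn : |z.re| ≤ ‖z - Complex.I * b‖ := by
      have := Complex.abs_re_le_norm (z - Complex.I * b)
      simpa using this
    have hd0 : z ≠ Complex.I * b := by
      intro h
      rw [h] at hr
      simp at hr
    have h4 : ‖e z‖ ≤ 4 * ((C + |c|) / |z.re|) := by
      rw [he]
      simp only
      rw [dslope_of_ne _ hd0, slope_def_field, hc, norm_mul, norm_div]
      have h5 : ‖deriv f z - c‖ ≤ C + |c| := by
        refine (norm_sub_le _ _).trans ?_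
        have : C / |z.re| ≤ C := div_le_self hC h3
        have h6 : ‖(c : ℂ)‖ = |c| := by simp
        rw [h6]
        linarith
      have h6 : ‖(4 : ℂ)‖ = 4 := by simp
      rw [h6]
      gcongr
    have h5 : ‖((starRingEnd ℂ) (f z) + G z) * deriv f z‖ ≤ (C + C) * (C / |z.re|) := by
      rw [norm_mul]
      have : ‖(starRingEnd ℂ) (f z) + G z‖ ≤ C + C := by
        refine (norm_add_le _ _).trans ?_
        rw [Complex.norm_conj]
        linarith
      gcongr
    have h6 : ‖(f z + (starRingEnd ℂ) (G z)) * deriv G z‖ ≤ (C + C) * (C / |z.re|) := by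
      rw [norm_mul]
      have : ‖f z + (starRingEnd ℂ) (G z)‖ ≤ C + C := by
        refine (norm_add_le _ _).trans ?_
        rw [Complex.norm_conj]
        linarith
      gcongr
    have h7 : ‖F z‖ ≤ (C + C) * (C / |z.re|) + (C + C) * (C / |z.re|)
        + 4 * ((C + |c|) / |z.re|) :=
      (norm_sub_le _ _).trans (add_le_add ((norm_add_le _ _).trans (add_le_add h5 h6)) h4)
    refine h7.trans (le_of_eq ?_)
    rw [hB]
    ring
  have hsideI : ∀ N : ℝ, 1 ≤ |N| → ‖∫ y in (-H)..H, F ((N : ℝ) + y * Complex.I)‖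
      ≤ B / |N| * (2 * H) := by
    intro N hN
    have := intervalIntegral.norm_integral_le_of_norm_le_const (a := -H) (b := H)
      (f := fun y : ℝ => F ((N : ℝ) + y * Complex.I)) (C := B / |N|) ?_
    · refine this.trans (le_of_eq ?_)
      rw [abs_of_nonneg (by linarith : 0 ≤ H - -H)]
      ring
    · intro y hy
      rw [Set.uIoc_of_le (by linarith)] at hy
      have := hside ((N : ℝ) + y * Complex.I) (by simpa using hy.1.le) (by simpa using hy.2)
        (by simpa using hN)
      simpa using this
  have hsideT : Filter.Tendsto (fun N : ℝ =>
      (Complex.I * (∫ y in (-H)..H, F ((N : ℝ) + y * Complex.I)) -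
      Complex.I * (∫ y in (-H)..H, F ((-N : ℝ) + y * Complex.I))).im) Filter.atTop (nhds 0) := by
    have ht : Filter.Tendsto (fun N : ℝ => (B * (2 * H) * 2) / N) Filter.atTop (nhds 0) :=
      Filter.Tendsto.const_div_atTop Filter.tendsto_id _
    refine squeeze_zero_norm' ?_ ht
    filter_upwards [Filter.eventually_ge_atTop 1] with N hN
    have h1 := hsideI N (by rw [abs_of_nonneg (by linarith)]; exact hN)
    have h2 := hsideI (-N) (by rw [abs_neg, abs_of_nonneg (by linarith)]; exact hN)
    rw [Real.norm_eq_abs]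
    refine (Complex.abs_im_le_norm _).trans ((norm_sub_le _ _).trans ?_)
    rw [norm_mul, norm_mul, Complex.norm_I, one_mul, one_mul]
    refine (add_le_add h1 h2).trans (le_of_eq ?_)
    rw [abs_neg, abs_of_nonneg (by linarith : (0 : ℝ) ≤ N)]
    ring
  -- limit of the rectangle integrals
  have hlim : Filter.Tendsto (fun N : ℝ => ∫ z in Set.Icc (-N) N ×ℂ Set.Icc (-H) H, φ z)
      Filter.atTop (nhds (8 * π * c - 2 * π / (H - b) ^ 2 - 2 * π / (H + b) ^ 2)) := by
    have l1 := line_tendsto c (h := H - b) (by linarith)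
    have l2 := line_tendsto c (h := H + b) (by linarith)
    have l3 := (l2.neg.sub l1).add hsideT
    have e0 : -(-(4 * c) * π + 2 * π / (H + b) ^ 2) - (-(4 * c) * π + 2 * π / (H - b) ^ 2) + 0
        = 8 * π * c - 2 * π / (H - b) ^ 2 - 2 * π / (H + b) ^ 2 := by ring
    rw [e0] at l3
    refine l3.congr' ?_
    filter_upwards [Filter.eventually_ge_atTop 0] with N hN
    rw [← rect_stokes hU hf hG hed hN hH.le (hrs N) F hF]
    have t1 := hline H (Or.inl rfl) N
    have t2 := hline (-H) (Or.inr rfl) N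
    rw [add_sub_assoc, Complex.add_im]
    congr 1
    rw [Complex.sub_im, t1, t2, ← intervalIntegral.integral_neg]
    congr 1
    refine intervalIntegral.integral_congr fun x _ => ?_
    have : (-H - b) ^ 2 = (H + b) ^ 2 := by ring
    simp only [this]
    ring
  -- covering argument
  set S' : Set ℂ := {z : ℂ | -H ≤ z.im ∧ z.im ≤ H} with hS'
  have hmS' : MeasurableSet S' :=
    (measurableSet_le measurable_const Complex.measurable_im).inter
      (measurableSet_le Complex.measurable_im measurable_const)
  have hrm : ∀ N : ℝ, MeasurableSet (Set.Icc (-N) N ×ℂ Set.Icc (-H) H) := fun N =>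
    (isCompact_Icc.reProdIm isCompact_Icc).measurableSet
  have hcov : AECover (volume.restrict S') Filter.atTop
      (fun N : ℝ => Set.Icc (-N) N ×ℂ Set.Icc (-H) H) := by
    refine ⟨?_, hrm⟩
    rw [ae_restrict_iff' hmS']
    refine Filter.Eventually.of_forall fun z hz => ?_
    filter_upwards [Filter.eventually_ge_atTop |z.re|] with N hN
    rw [Complex.mem_reProdIm]
    exact ⟨abs_le.mp hN, hz⟩
  have hrr : ∀ N : ℝ, (volume.restrict S').restrict (Set.Icc (-N) N ×ℂ Set.Icc (-H) H)
      = volume.restrict (Set.Icc (-N) N ×ℂ Set.Icc (-H) H) := by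
    intro N
    rw [Measure.restrict_restrict (hrm N)]
    congr 1
    refine Set.inter_eq_left.mpr fun z hz => ?_
    rw [Complex.mem_reProdIm] at hz
    exact hz.2
  have hn : 0 ≤ᵐ[volume.restrict S'] φ := Filter.Eventually.of_forall fun z => by
    simp only [hφ, Pi.zero_apply]
    positivity
  have hfi : ∀ N : ℝ, IntegrableOn φ (Set.Icc (-N) N ×ℂ Set.Icc (-H) H) (volume.restrict S') := by
    intro N
    rw [IntegrableOn, hrr]
    exact (hφc.mono (hrs N)).integrableOn_compact (isCompact_Icc.reProdIm isCompact_Icc)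
  have hlim' : Filter.Tendsto (fun N : ℝ => ∫ z in Set.Icc (-N) N ×ℂ Set.Icc (-H) H, φ z
      ∂(volume.restrict S')) Filter.atTop
      (nhds (8 * π * c - 2 * π / (H - b) ^ 2 - 2 * π / (H + b) ^ 2)) := by
    simp_rw [hrr]
    exact hlim
  have r1 : IntegrableOn φ S' := hcov.integrable_of_integral_tendsto_of_nonneg_ae _ hfi hn hlim'
  have r2 := hcov.integral_eq_of_tendsto_of_nonneg_ae _ hn hfi hlim'
  have hset : {z : ℂ | -H < z.im ∧ z.im < H} =ᵐ[volume] S' := by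
    have a1 : ∀ᵐ z : ℂ, z.im ≠ H := by
      rw [ae_iff]
      simpa using null_line H
    have a2 : ∀ᵐ z : ℂ, z.im ≠ -H := by
      rw [ae_iff]
      simpa using null_line (-H)
    filter_upwards [a1, a2] with z h1 h2
    apply propext
    change (-H < z.im ∧ z.im < H) ↔ (-H ≤ z.im ∧ z.im ≤ H)
    exact ⟨fun h => ⟨h.1.le, h.2.le⟩,
      fun h => ⟨lt_of_le_of_ne h.1 (Ne.symm h2), lt_of_le_of_ne h.2 h1⟩⟩
  exact ⟨r1.congr_set_ae hset, by rw [setIntegral_congr_set hset]; exact r2⟩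

lemma normsq_sinh (w : ℂ) : ‖Complex.sinh w‖ ^ 2 = Real.sinh w.re ^ 2 + Real.sin w.im ^ 2 := by
  have h : Complex.sinh w = ((Real.sinh w.re * Real.cos w.im : ℝ) : ℂ)
      + ((Real.cosh w.re * Real.sin w.im : ℝ) : ℂ) * Complex.I := by
    conv_lhs => rw [← Complex.re_add_im w]
    rw [Complex.sinh_add, Complex.cosh_mul_I, Complex.sinh_mul_I]
    push_cast
    ring
  rw [h, ← Complex.normSq_eq_norm_sq, Complex.normSq_add_mul_I]
  have h1 := Real.cosh_sq w.re
  have h2 := Real.sin_sq_add_cos_sq w.im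
  rw [mul_pow, mul_pow, h1]
  linear_combination (Real.sinh w.re) ^ 2 * h2

lemma normsq_cosh (w : ℂ) : ‖Complex.cosh w‖ ^ 2 = Real.sinh w.re ^ 2 + Real.cos w.im ^ 2 := by
  have h : Complex.cosh w = ((Real.cosh w.re * Real.cos w.im : ℝ) : ℂ)
      + ((Real.sinh w.re * Real.sin w.im : ℝ) : ℂ) * Complex.I := by
    conv_lhs => rw [← Complex.re_add_im w]
    rw [Complex.cosh_add, Complex.cosh_mul_I, Complex.sinh_mul_I]
    push_cast
    ring
  rw [h, ← Complex.normSq_eq_norm_sq, Complex.normSq_add_mul_I]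
  have h1 := Real.cosh_sq w.re
  have h2 := Real.sin_sq_add_cos_sq w.im
  rw [mul_pow, mul_pow, h1]
  linear_combination (Real.sinh w.re) ^ 2 * h2

lemma le_norm_sinh (w : ℂ) : |w.re| ≤ ‖Complex.sinh w‖ ∧ |w.re| ≤ ‖Complex.cosh w‖
    ∧ ‖Complex.sinh w‖ ≤ 1 + ‖Complex.cosh w‖ ∧ ‖Complex.cosh w‖ ≤ 1 + ‖Complex.sinh w‖ := by
  have h0 : |w.re| ≤ |Real.sinh w.re| := by
    rw [Real.abs_sinh]
    exact Real.self_le_sinh_iff.mpr (abs_nonneg _)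
  have h1 := normsq_sinh w
  have h2 := normsq_cosh w
  have h3 := Real.sin_sq_add_cos_sq w.im
  have a1 : |w.re| ^ 2 ≤ Real.sinh w.re ^ 2 := by
    rw [← sq_abs (Real.sinh w.re)]
    gcongr
  have n1 := norm_nonneg (Complex.sinh w)
  have n2 := norm_nonneg (Complex.cosh w)
  refine ⟨abs_le_of_sq_le_sq' ?_ n1 |>.2, abs_le_of_sq_le_sq' ?_ n2 |>.2,
    abs_le_of_sq_le_sq' ?_ (by positivity) |>.2, abs_le_of_sq_le_sq' ?_ (by positivity) |>.2⟩
  all_goals nlinarith [sq_nonneg (Real.sin w.im), sq_nonneg (Real.cos w.im)]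

lemma cosh_ne_zero_of {w : ℂ} (h1 : -(π / 2) < w.im) (h2 : w.im < π / 2) :
    Complex.cosh w ≠ 0 := by
  intro h
  have := normsq_cosh w
  rw [h] at this
  have hc := Real.cos_pos_of_mem_Ioo ⟨h1, h2⟩
  have : 0 < Real.cos w.im ^ 2 := by positivity
  have : 0 ≤ Real.sinh w.re ^ 2 := by positivity
  simp at *
  linarith

lemma sinh_ne_zero_of {w : ℂ} (hw : w ≠ 0) (h1 : -π < w.im) (h2 : w.im < π) :
    Complex.sinh w ≠ 0 := by
  intro h
  have h3 := normsq_sinh w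
  rw [h, norm_zero] at h3
  have p1 : 0 ≤ Real.sin w.im ^ 2 := by positivity
  have p2 : 0 ≤ Real.sinh w.re ^ 2 := by positivity
  have e1 : Real.sinh w.re = 0 := by
    have : Real.sinh w.re ^ 2 = 0 := by linarith
    simpa using this
  have e2 : Real.sin w.im = 0 := by
    have : Real.sin w.im ^ 2 = 0 := by linarith
    simpa using this
  apply hw
  apply Complex.ext
  · simpa using e1
  · exact (Real.sin_eq_zero_iff_of_lt_of_lt h1 h2).mp e2

/-- `coth w - 1/w` with the singularity at `0` removed. -/
def kfun (w : ℂ) : ℂ :=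
  dslope (fun w => Complex.cosh w - dslope Complex.sinh 0 w) 0 w / dslope Complex.sinh 0 w

lemma diff_dslope {g : ℂ → ℂ} (hg : Differentiable ℂ g) : Differentiable ℂ (dslope g 0) := by
  rw [← differentiableOn_univ]
  exact (Complex.differentiableOn_dslope Filter.univ_mem).mpr hg.differentiableOn

lemma kfun_diff {w : ℂ} (h1 : -π < w.im) (h2 : w.im < π) : DifferentiableAt ℂ kfun w := by
  have d1 := diff_dslope Complex.differentiable_sinh
  have d2 := diff_dslope (Complex.differentiable_cosh.sub d1)
  refine (d2 w).div (d1 w) ?_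
  by_cases hw : w = 0
  · rw [hw, dslope_same]
    simp
  · rw [dslope_of_ne _ hw, slope_def_field]
    simp [hw, sinh_ne_zero_of hw h1 h2]

lemma kfun_eq {w : ℂ} (hw : w ≠ 0) (h1 : -π < w.im) (h2 : w.im < π) :
    kfun w = cothC w - 1 / w := by
  have hs := sinh_ne_zero_of hw h1 h2
  rw [kfun, cothC, dslope_of_ne _ hw, slope_def_field, dslope_of_ne _ hw, slope_def_field,
    dslope_same]
  simp
  field_simp

/-- holomorphic part -/
def fF (a b : ℝ) (z : ℂ) : ℂ := 2 * a * Complex.tanh (a * (z + Complex.I * b))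

/-- conjugate of the antiholomorphic part -/
def gG (a b : ℝ) (z : ℂ) : ℂ := -(2 * a) * kfun (a * (z - Complex.I * b))

/-- A neighbourhood of the closed strip. -/
def nbU (ℓ b : ℝ) : Set ℂ := {z : ℂ | -ℓ < z.im + b ∧ z.im + b < ℓ}

lemma nbU_open (ℓ b : ℝ) : IsOpen (nbU ℓ b) := by
  have hc : Continuous fun z : ℂ => z.im + b := Complex.continuous_im.add continuous_const
  have h1 : IsOpen {z : ℂ | -ℓ < z.im + b} := isOpen_lt continuous_const hc
  have h2 : IsOpen {z : ℂ | z.im + b < ℓ} := isOpen_lt hc continuous_const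
  exact h1.inter h2

lemma im_plus (a b : ℝ) (z : ℂ) : ((a : ℂ) * (z + Complex.I * b)).im = a * (z.im + b) := by simp
lemma im_minus (a b : ℝ) (z : ℂ) : ((a : ℂ) * (z - Complex.I * b)).im = a * (z.im - b) := by simp
lemma re_plus (a b : ℝ) (z : ℂ) : ((a : ℂ) * (z + Complex.I * b)).re = a * z.re := by simp
lemma re_minus (a b : ℝ) (z : ℂ) : ((a : ℂ) * (z - Complex.I * b)).re = a * z.re := by simp

section concrete
variable {a b ℓ : ℝ}

lemma arg_plus (ha : 0 < a) (haℓ : a * ℓ = π / 2) {z : ℂ} (hz : z ∈ nbU ℓ b) :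
    Complex.cosh (a * (z + Complex.I * b)) ≠ 0 := by
  obtain ⟨h1, h2⟩ := hz
  apply cosh_ne_zero_of <;> rw [im_plus, ← haℓ] <;> nlinarith

lemma arg_minus (ha : 0 < a) (haℓ : a * ℓ = π / 2) (hb1 : -(ℓ / 2) < b) (hb2 : b < ℓ / 2) {z : ℂ}
    (hz : z ∈ nbU ℓ b) : -π < ((a : ℂ) * (z - Complex.I * b)).im ∧
      ((a : ℂ) * (z - Complex.I * b)).im < π := by
  obtain ⟨h1, h2⟩ := hz
  rw [im_minus]
  constructor <;> nlinarith

lemma fF_deriv (ha : 0 < a) (haℓ : a * ℓ = π / 2) {z : ℂ} (hz : z ∈ nbU ℓ b) :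
    HasDerivAt (fF a b) (2 * a ^ 2 / Complex.cosh (a * (z + Complex.I * b)) ^ 2) z := by
  have hc := arg_plus ha haℓ hz
  have d0 : HasDerivAt (fun z : ℂ => (a : ℂ) * (z + Complex.I * b)) a z := by
    simpa using ((hasDerivAt_id z).add_const (Complex.I * b)).const_mul (a : ℂ)
  have d1 := ((d0.csinh.div d0.ccosh hc).const_mul (2 * (a : ℂ)))
  have e : fF a b = fun z : ℂ => 2 * (a : ℂ) * (Complex.sinh (a * (z + Complex.I * b))
      / Complex.cosh (a * (z + Complex.I * b))) := by
    funext z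
    rw [fF, Complex.tanh_eq_sinh_div_cosh]
  rw [e]
  refine d1.congr_deriv ?_
  have h := Complex.cosh_sq_sub_sinh_sq (a * (z + Complex.I * b))
  field_simp
  linear_combination ((a : ℂ) ^ 2) * h

lemma gG_diff (ha : 0 < a) (haℓ : a * ℓ = π / 2) (hb1 : -(ℓ / 2) < b) (hb2 : b < ℓ / 2) {z : ℂ}
    (hz : z ∈ nbU ℓ b) : DifferentiableAt ℂ (gG a b) z := by
  obtain ⟨h1, h2⟩ := arg_minus ha haℓ hb1 hb2 hz
  have d0 : DifferentiableAt ℂ (fun z : ℂ => (a : ℂ) * (z - Complex.I * b)) z := by fun_prop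
  exact (DifferentiableAt.comp z (kfun_diff h1 h2) d0).const_mul (-(2 * (a : ℂ)))

lemma gG_eq (ha : 0 < a) (haℓ : a * ℓ = π / 2) (hb1 : -(ℓ / 2) < b) (hb2 : b < ℓ / 2) {z : ℂ}
    (hz : z ∈ nbU ℓ b) (hzb : z ≠ Complex.I * b) :
    gG a b z = -(2 * a) * cothC (a * (z - Complex.I * b)) + 2 / (z - Complex.I * b) := by
  obtain ⟨h1, h2⟩ := arg_minus ha haℓ hb1 hb2 hz
  have ha0 : (a : ℂ) ≠ 0 := by exact_mod_cast ha.ne'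
  have hd : z - Complex.I * b ≠ 0 := sub_ne_zero.mpr hzb
  rw [gG, kfun_eq (mul_ne_zero ha0 hd) h1 h2]
  field_simp
  ring

lemma gG_deriv (ha : 0 < a) (haℓ : a * ℓ = π / 2) (hb1 : -(ℓ / 2) < b) (hb2 : b < ℓ / 2) {z : ℂ}
    (hz : z ∈ nbU ℓ b) (hzb : z ≠ Complex.I * b) :
    HasDerivAt (gG a b) (2 * a ^ 2 / Complex.sinh (a * (z - Complex.I * b)) ^ 2
      - 2 / (z - Complex.I * b) ^ 2) z := by
  obtain ⟨h1, h2⟩ := arg_minus ha haℓ hb1 hb2 hz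
  have ha0 : (a : ℂ) ≠ 0 := by exact_mod_cast ha.ne'
  have hd : z - Complex.I * b ≠ 0 := sub_ne_zero.mpr hzb
  have hs := sinh_ne_zero_of (mul_ne_zero ha0 hd) h1 h2
  have d0 : HasDerivAt (fun z : ℂ => (a : ℂ) * (z - Complex.I * b)) a z := by
    simpa using ((hasDerivAt_id z).sub_const (Complex.I * b)).const_mul (a : ℂ)
  have d1 := ((d0.ccosh.div d0.csinh hs).const_mul (-(2 * (a : ℂ))))
  have d2 : HasDerivAt (fun z : ℂ => 2 / (z - Complex.I * b)) (-2 / (z - Complex.I * b) ^ 2) z := by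
    have := (hasDerivAt_const z (2 : ℂ)).div ((hasDerivAt_id z).sub_const (Complex.I * b)) hd
    refine this.congr_deriv ?_
    simp
  have d3 := d1.add d2
  have d4 : HasDerivAt (gG a b) _ z := d3.congr_of_eventuallyEq (by
    filter_upwards [(nbU_open ℓ b).mem_nhds hz, isOpen_ne.mem_nhds hzb] with w hw hwb
    rw [gG_eq ha haℓ hb1 hb2 hw hwb]
    rfl)
  refine d4.congr_deriv ?_
  have h := Complex.cosh_sq_sub_sinh_sq (a * (z - Complex.I * b))
  field_simp
  linear_combination ((a : ℂ) ^ 2 * (z - Complex.I * b) ^ 2) * h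

lemma closed_sub (hb1 : -(ℓ / 2) < b) (hb2 : b < ℓ / 2) (z : ℂ) (h1 : -(ℓ / 2) ≤ z.im)
    (h2 : z.im ≤ ℓ / 2) : z ∈ nbU ℓ b :=
  ⟨by linarith, by linarith⟩

lemma bdry_rel (ha : 0 < a) (haℓ : a * ℓ = π / 2) (hb1 : -(ℓ / 2) < b) (hb2 : b < ℓ / 2) (z : ℂ)
    (hz : z.im = ℓ / 2 ∨ z.im = -(ℓ / 2)) :
    gG a b z = 2 / (z - Complex.I * b) - (starRingEnd ℂ) (fF a b z) := by
  have hzU : z ∈ nbU ℓ b := by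
    apply closed_sub hb1 hb2 <;> rcases hz with h | h <;> linarith
  have hzb : z ≠ Complex.I * b := by
    intro h
    have : z.im = b := by rw [h]; simp
    rcases hz with h | h <;> linarith
  rw [gG_eq ha haℓ hb1 hb2 hzU hzb]
  have hconj : (starRingEnd ℂ) (fF a b z)
      = 2 * a * Complex.tanh (a * ((starRingEnd ℂ) z - Complex.I * b)) := by
    rw [fF, map_mul, map_mul, map_ofNat, Complex.conj_ofReal, ← Complex.tanh_conj]
    simp [sub_eq_add_neg]
  rw [hconj]
  set w := (a : ℂ) * ((starRingEnd ℂ) z - Complex.I * b) with hw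
  have haℓ' : (a : ℂ) * ℓ = π / 2 := by exact_mod_cast haℓ
  have hcoth : cothC (a * (z - Complex.I * b)) = Complex.tanh w := by
    rw [cothC, Complex.tanh_eq_sinh_div_cosh]
    rcases hz with h | h
    · have e : (a : ℂ) * (z - Complex.I * b) = w + (π / 2 : ℂ) * Complex.I := by
        rw [← haℓ', hw]
        have : z - (starRingEnd ℂ) z = ℓ * Complex.I := by
          rw [Complex.sub_conj, h]
          push_cast
          ring
        linear_combination (a : ℂ) * this
      rw [e, Complex.cosh_add, Complex.sinh_add, Complex.cosh_mul_I, Complex.sinh_mul_I,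
        Complex.cos_pi_div_two, Complex.sin_pi_div_two]
      simp only [mul_zero, zero_add, one_mul]
      rw [mul_div_mul_right _ _ Complex.I_ne_zero]
    · have e : (a : ℂ) * (z - Complex.I * b) = w - (π / 2 : ℂ) * Complex.I := by
        rw [← haℓ', hw]
        have : z - (starRingEnd ℂ) z = -ℓ * Complex.I := by
          rw [Complex.sub_conj, h]
          push_cast
          ring
        linear_combination (a : ℂ) * this
      rw [e, Complex.cosh_sub, Complex.sinh_sub, Complex.cosh_mul_I, Complex.sinh_mul_I,
        Complex.cos_pi_div_two, Complex.sin_pi_div_two]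
      simp only [mul_zero, zero_sub, one_mul]
      rw [neg_div_neg_eq, mul_div_mul_right _ _ Complex.I_ne_zero]
  rw [hcoth]
  ring

lemma decay (ha : 0 < a) (haℓ : a * ℓ = π / 2) (hb1 : -(ℓ / 2) < b) (hb2 : b < ℓ / 2) (z : ℂ)
    (h1 : -(ℓ / 2) ≤ z.im) (h2 : z.im ≤ ℓ / 2) (h3 : 1 ≤ |z.re|) :
    ‖fF a b z‖ ≤ 2 * a + 4 ∧ ‖gG a b z‖ ≤ 2 * a + 4 ∧
      ‖deriv (fF a b) z‖ ≤ (2 * a + 4) / |z.re| ∧ ‖deriv (gG a b) z‖ ≤ (2 * a + 4) / |z.re| := by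
  have hz := closed_sub hb1 hb2 z h1 h2
  have hT : 0 < |z.re| := by linarith
  set T := |z.re| with hTd
  have hzb : z ≠ Complex.I * b := by
    intro h
    rw [hTd, h] at hT
    simp at hT
  obtain ⟨_, p2, p3, _⟩ := le_norm_sinh ((a : ℂ) * (z + Complex.I * b))
  obtain ⟨m1, _, _, m4⟩ := le_norm_sinh ((a : ℂ) * (z - Complex.I * b))
  rw [re_plus, abs_mul, abs_of_pos ha, ← hTd] at p2
  rw [re_minus, abs_mul, abs_of_pos ha, ← hTd] at m1
  have haT : 0 < a * T := by positivity
  have haa : a ≤ a * T := by nlinarith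
  have hd : T ≤ ‖z - Complex.I * b‖ := by
    have := Complex.abs_re_le_norm (z - Complex.I * b)
    simpa using this
  have quot : ∀ s c : ℝ, a * T ≤ c → s ≤ 1 + c → 2 * a * (s / c) ≤ 2 * a + 2 := by
    intro s c h h'
    have hc : 0 < c := by linarith
    rw [mul_div_assoc', div_le_iff₀ hc]
    nlinarith
  have inv2 : ∀ c : ℝ, a * T ≤ c → 2 * a ^ 2 / c ^ 2 ≤ 2 / T := by
    intro c h
    have hc : 0 < c := by linarith
    have : (a * T) ^ 2 ≤ c ^ 2 := by gcongr
    rw [div_le_div_iff₀ (by positivity) hT]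
    have hTT : a ^ 2 * T ≤ (a * T) ^ 2 := by
      have : 0 < a ^ 2 * T := by positivity
      nlinarith
    linarith
  have na : ‖(2 * a : ℂ)‖ = 2 * a := by
    rw [norm_mul, Complex.norm_real, Real.norm_eq_abs, abs_of_pos ha]
    simp
  have na2 : ‖(2 * a ^ 2 : ℂ)‖ = 2 * a ^ 2 := by
    rw [norm_mul, norm_pow, Complex.norm_real, Real.norm_eq_abs, abs_of_pos ha]
    simp
  have hD1 : 2 / ‖z - Complex.I * b‖ ≤ 2 := by
    rw [div_le_iff₀ (by linarith)]
    linarith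
  have hD2 : 2 / ‖z - Complex.I * b‖ ^ 2 ≤ 2 / T := by
    have : T ≤ ‖z - Complex.I * b‖ ^ 2 := by nlinarith
    gcongr
  refine ⟨?_, ?_, ?_, ?_⟩
  · rw [fF, Complex.tanh_eq_sinh_div_cosh, norm_mul, na, norm_div]
    have := quot _ _ p2 p3
    linarith
  · rw [gG_eq ha haℓ hb1 hb2 hz hzb, cothC]
    refine (norm_add_le _ _).trans ?_
    rw [norm_mul, norm_neg, na, norm_div, norm_div, Complex.norm_ofNat]
    have := quot _ _ m1 m4
    linarith
  · rw [(fF_deriv ha haℓ hz).deriv, norm_div, na2, norm_pow]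
    refine (inv2 _ p2).trans ?_
    exact div_le_div_of_nonneg_right (by linarith) hT.le
  · rw [(gG_deriv ha haℓ hb1 hb2 hz hzb).deriv]
    refine (norm_sub_le _ _).trans ?_
    rw [norm_div, norm_div, na2, norm_pow, norm_pow, Complex.norm_ofNat]
    refine (add_le_add (inv2 _ m1) hD2).trans ?_
    rw [← add_div]
    exact div_le_div_of_nonneg_right (by linarith) hT.le

lemma fF_at (ha : 0 < a) (haℓ : a * ℓ = π / 2) (hb1 : -(ℓ / 2) < b) (hb2 : b < ℓ / 2) :
    deriv (fF a b) (Complex.I * b) = ((2 * a ^ 2 / Real.cos (2 * a * b) ^ 2 : ℝ) : ℂ) := by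
  have hz : Complex.I * b ∈ nbU ℓ b :=
    closed_sub hb1 hb2 _ (by simpa using hb1.le) (by simpa using hb2.le)
  rw [(fF_deriv ha haℓ hz).deriv]
  have : (a : ℂ) * (Complex.I * b + Complex.I * b) = ((2 * a * b : ℝ) : ℂ) * Complex.I := by
    push_cast
    ring
  rw [this, Complex.cosh_mul_I]
  push_cast
  rfl

end concrete

/-- The continuous extension. -/
def vV (ℓ a b : ℝ) (z : ℂ) : ℂ :=
  if -(ℓ / 2) < z.im ∧ z.im < ℓ / 2 then fF a b z + (starRingEnd ℂ) (gG a b z)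
  else (starRingEnd ℂ) (2 / (z - Complex.I * b))

section final
variable {a b ℓ : ℝ}

lemma vV_closed (ha : 0 < a) (haℓ : a * ℓ = π / 2) (hb1 : -(ℓ / 2) < b) (hb2 : b < ℓ / 2) {z : ℂ}
    (h1 : -(ℓ / 2) ≤ z.im) (h2 : z.im ≤ ℓ / 2) :
    vV ℓ a b z = fF a b z + (starRingEnd ℂ) (gG a b z) := by
  rw [vV]
  split_ifs with h
  · rfl
  · have hz : z.im = ℓ / 2 ∨ z.im = -(ℓ / 2) := by
      by_contra hcon
      push Not at hcon
      exact h ⟨lt_of_le_of_ne h1 (Ne.symm hcon.2), lt_of_le_of_ne h2 hcon.1⟩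
    rw [bdry_rel ha haℓ hb1 hb2 z hz, map_sub, Complex.conj_conj]
    ring

lemma vV_out {z : ℂ} (h : ¬ (-(ℓ / 2) < z.im ∧ z.im < ℓ / 2)) :
    vV ℓ a b z = (starRingEnd ℂ) (2 / (z - Complex.I * b)) := by
  rw [vV, if_neg h]

lemma strip_open (H : ℝ) : IsOpen {z : ℂ | -H < z.im ∧ z.im < H} := by
  have h1 : IsOpen {z : ℂ | -H < z.im} := isOpen_lt continuous_const Complex.continuous_im
  have h2 : IsOpen {z : ℂ | z.im < H} := isOpen_lt Complex.continuous_im continuous_const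
  exact h1.inter h2

lemma out_ne (hb1 : -(ℓ / 2) < b) (hb2 : b < ℓ / 2) {z : ℂ}
    (h : ¬ (-(ℓ / 2) < z.im ∧ z.im < ℓ / 2)) : z - Complex.I * b ≠ 0 := by
  intro h0
  rw [sub_eq_zero] at h0
  apply h
  rw [h0]
  simpa using ⟨hb1, hb2⟩

lemma vV_cont (ha : 0 < a) (haℓ : a * ℓ = π / 2) (hb1 : -(ℓ / 2) < b) (hb2 : b < ℓ / 2) :
    Continuous (vV ℓ a b) := by
  have k1 : IsClosed {z : ℂ | -(ℓ / 2) ≤ z.im ∧ z.im ≤ ℓ / 2} := by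
    have h1 : IsClosed {z : ℂ | -(ℓ / 2) ≤ z.im} := isClosed_le continuous_const Complex.continuous_im
    have h2 : IsClosed {z : ℂ | z.im ≤ ℓ / 2} := isClosed_le Complex.continuous_im continuous_const
    exact h1.inter h2
  have k2 : IsClosed {z : ℂ | ¬ (-(ℓ / 2) < z.im ∧ z.im < ℓ / 2)} :=
    (strip_open (ℓ / 2)).isClosed_compl
  have c1 : ContinuousOn (vV ℓ a b) {z : ℂ | -(ℓ / 2) ≤ z.im ∧ z.im ≤ ℓ / 2} := by
    have : ContinuousOn (fun z => fF a b z + (starRingEnd ℂ) (gG a b z))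
        {z : ℂ | -(ℓ / 2) ≤ z.im ∧ z.im ≤ ℓ / 2} := by
      intro z hz
      have hU := closed_sub hb1 hb2 z hz.1 hz.2
      exact ((fF_deriv ha haℓ hU).continuousAt.add
        (Complex.continuous_conj.continuousAt.comp
          (gG_diff ha haℓ hb1 hb2 hU).continuousAt)).continuousWithinAt
    exact this.congr fun z hz => vV_closed ha haℓ hb1 hb2 hz.1 hz.2
  have c2 : ContinuousOn (vV ℓ a b) {z : ℂ | ¬ (-(ℓ / 2) < z.im ∧ z.im < ℓ / 2)} := by
    have : ContinuousOn (fun z => (starRingEnd ℂ) (2 / (z - Complex.I * b)))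
        {z : ℂ | ¬ (-(ℓ / 2) < z.im ∧ z.im < ℓ / 2)} := by
      intro z hz
      have hne := out_ne hb1 hb2 hz
      have : ContinuousAt (fun z : ℂ => 2 / (z - Complex.I * b)) z := by
        fun_prop (disch := assumption)
      exact (Complex.continuous_conj.continuousAt.comp this).continuousWithinAt
    exact this.congr fun z hz => vV_out hz
  have c3 := c1.union_of_isClosed c2 k1 k2
  rw [← continuousOn_univ]
  refine c3.mono fun z _ => ?_
  by_cases h : -(ℓ / 2) < z.im ∧ z.im < ℓ / 2
  · exact Or.inl ⟨h.1.le, h.2.le⟩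
  · exact Or.inr h

lemma conj_coth (w : ℂ) : (starRingEnd ℂ) (cothC w) = cothC ((starRingEnd ℂ) w) := by
  rw [cothC, cothC, map_div₀, Complex.cosh_conj, Complex.sinh_conj]

lemma conj_sub_p (z : ℂ) (b : ℝ) :
    (starRingEnd ℂ) (z - Complex.I * b) = (starRingEnd ℂ) z + Complex.I * b := by
  simp

lemma vV_energy (ha : 0 < a) (haℓ : a * ℓ = π / 2) (hb1 : -(ℓ / 2) < b) (hb2 : b < ℓ / 2) :
    dirE (vV ℓ a b) = 8 * π * (2 * a ^ 2 / Real.cos (2 * a * b) ^ 2) := by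
  have df : DifferentiableOn ℂ (fF a b) (nbU ℓ b) := fun z hz =>
    (fF_deriv ha haℓ hz).differentiableAt.differentiableWithinAt
  have dg : DifferentiableOn ℂ (gG a b) (nbU ℓ b) := fun z hz =>
    (gG_diff ha haℓ hb1 hb2 hz).differentiableWithinAt
  obtain ⟨i1, e1⟩ := strip_energy (nbU_open ℓ b) df dg hb1 hb2 (closed_sub hb1 hb2)
    (fF_at ha haℓ hb1 hb2) (bdry_rel ha haℓ hb1 hb2) (decay ha haℓ hb1 hb2)
  obtain ⟨i2, e2⟩ := outer_energy hb1 hb2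
  set S : Set ℂ := {z : ℂ | -(ℓ / 2) < z.im ∧ z.im < ℓ / 2} with hS
  have hSo : IsOpen S := strip_open (ℓ / 2)
  have hSc : {z : ℂ | ¬ (-(ℓ / 2) < z.im ∧ z.im < ℓ / 2)} = Sᶜ := rfl
  rw [hSc] at i2 e2
  set W : ℂ → ℝ := fun z => ‖fderiv ℝ (fun w => (vV ℓ a b w).re) z‖ ^ 2
    + ‖fderiv ℝ (fun w => (vV ℓ a b w).im) z‖ ^ 2 with hW
  have q1 : ∀ z ∈ S, W z = 2 * ‖deriv (fF a b) z‖ ^ 2 + 2 * ‖deriv (gG a b) z‖ ^ 2 := by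
    intro z hz
    have hU := closed_sub hb1 hb2 z hz.1.le hz.2.le
    have hd := hasFDerivAt_AB (fF_deriv ha haℓ hU).differentiableAt.hasDerivAt
      (gG_diff ha haℓ hb1 hb2 hU).hasDerivAt
    refine density_AB (hd.congr_of_eventuallyEq ?_)
    filter_upwards [hSo.mem_nhds hz] with w hw
    exact vV_closed ha haℓ hb1 hb2 hw.1.le hw.2.le
  have q2 : ∀ z ∈ Sᶜ, z.im ≠ ℓ / 2 → z.im ≠ -(ℓ / 2) →
      W z = 8 / ‖z - Complex.I * (b : ℂ)‖ ^ 4 := by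
    intro z hz n1 n2
    have hne := out_ne hb1 hb2 hz
    have d2 : HasDerivAt (fun z : ℂ => 2 / (z - Complex.I * b))
        (-2 / (z - Complex.I * b) ^ 2) z := by
      have := (hasDerivAt_const z (2 : ℂ)).div ((hasDerivAt_id z).sub_const (Complex.I * b)) hne
      refine this.congr_deriv ?_
      simp
    have hd := hasFDerivAt_AB (hasDerivAt_const z (0 : ℂ)) d2
    have hcl : IsClosed {z : ℂ | -(ℓ / 2) ≤ z.im ∧ z.im ≤ ℓ / 2} := by
      have h1 : IsClosed {z : ℂ | -(ℓ / 2) ≤ z.im} :=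
        isClosed_le continuous_const Complex.continuous_im
      have h2 : IsClosed {z : ℂ | z.im ≤ ℓ / 2} :=
        isClosed_le Complex.continuous_im continuous_const
      exact h1.inter h2
    have hz' : z ∈ {z : ℂ | -(ℓ / 2) ≤ z.im ∧ z.im ≤ ℓ / 2}ᶜ := fun h =>
      hz ⟨lt_of_le_of_ne h.1 (Ne.symm n2), lt_of_le_of_ne h.2 n1⟩
    have := density_AB (hd.congr_of_eventuallyEq (f₁ := vV ℓ a b) (by
      filter_upwards [hcl.isOpen_compl.mem_nhds hz'] with w hw
      rw [vV_out fun h => hw ⟨h.1.le, h.2.le⟩]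
      simp))
    rw [hW]
    refine this.trans ?_
    rw [norm_zero, norm_div, norm_pow, norm_neg, Complex.norm_ofNat, div_pow]
    ring
  have q2' : W =ᵐ[volume.restrict Sᶜ] fun z => 8 / ‖z - Complex.I * (b : ℂ)‖ ^ 4 := by
    have l1 : ∀ᵐ z : ℂ, z.im ≠ ℓ / 2 := by
      rw [ae_iff]
      simpa using null_line (ℓ / 2)
    have l2 : ∀ᵐ z : ℂ, z.im ≠ -(ℓ / 2) := by
      rw [ae_iff]
      simpa using null_line (-(ℓ / 2))
    filter_upwards [ae_restrict_mem hSo.measurableSet.compl, ae_restrict_of_ae l1,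
      ae_restrict_of_ae l2] with z h1 h2 h3
    exact q2 z h1 h2 h3
  have j1 : IntegrableOn W S := i1.congr_fun (fun z hz => (q1 z hz).symm) hSo.measurableSet
  have j2 : IntegrableOn W Sᶜ := i2.congr q2'.symm
  have jW : Integrable W := by
    rw [← integrableOn_univ, ← Set.union_compl_self S]
    exact j1.union j2
  have : dirE (vV ℓ a b) = ∫ z, W z := rfl
  rw [this, ← integral_add_compl hSo.measurableSet jW,
    setIntegral_congr_fun hSo.measurableSet q1, integral_congr_ae q2', e1, e2]
  ring

end final


/-- for `ℓ > 0` and `y₀ ∈ (−ℓ/2, ℓ/2)`, the map `stripU ℓ y₀` extends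
to a continuous function `v` on `ℂ` (the singularity at `iy₀` being removable),
which is harmonic on the strip `Ω_ℓ` and has Dirichlet energy
`4π³/(ℓ² cos²(πy₀/ℓ))`; this energy is at least `4π³/ℓ²`, the value at `y₀ = 0`. -/
theorem strip_tail_energy (ℓ y₀ : ℝ) (hℓ : 0 < ℓ)
    (hy : -ℓ / 2 < y₀ ∧ y₀ < ℓ / 2) :
    ∃ v : ℂ → ℂ, Continuous v ∧
      (∀ z : ℂ, z ≠ Complex.I * (y₀ : ℂ) → v z = stripU ℓ y₀ z) ∧
      HarmOn v {z : ℂ | -ℓ / 2 < z.im ∧ z.im < ℓ / 2} ∧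
      dirE v = 4 * π ^ 3 / (ℓ ^ 2 * Real.cos (π * y₀ / ℓ) ^ 2) ∧
      4 * π ^ 3 / ℓ ^ 2 ≤ 4 * π ^ 3 / (ℓ ^ 2 * Real.cos (π * y₀ / ℓ) ^ 2) := by
  have hb1 : -(ℓ / 2) < y₀ := by linarith [hy.1]
  have hb2 : y₀ < ℓ / 2 := hy.2
  have hneg : -ℓ / 2 = -(ℓ / 2) := by ring
  set a : ℝ := π / (2 * ℓ) with had
  have ha : 0 < a := by have := Real.pi_pos; positivity
  have haℓ : a * ℓ = π / 2 := by rw [had]; field_simp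
  have h2a : π / ℓ = 2 * a := by rw [had]; field_simp
  have harg : π * y₀ / ℓ = 2 * a * y₀ := by rw [← h2a]; ring
  have hcos : 0 < Real.cos (π * y₀ / ℓ) := by
    rw [harg]
    apply Real.cos_pos_of_mem_Ioo
    constructor <;> nlinarith
  refine ⟨vV ℓ a y₀, vV_cont ha haℓ hb1 hb2, ?_, ?_, ?_, ?_⟩
  · intro z hz
    rw [vV, stripU, hneg, ← had, h2a]
    split_ifs with h
    · have hU := closed_sub hb1 hb2 z h.1.le h.2.le
      rw [gG_eq ha haℓ hb1 hb2 hU hz, fF, map_add, map_mul, conj_coth, map_mul, map_div₀,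
        conj_sub_p, Complex.conj_ofReal]
      simp only [map_neg, map_mul, map_ofNat, Complex.conj_ofReal]
      push_cast
      ring
    · rw [map_div₀, conj_sub_p, map_ofNat]
  · rw [hneg]
    refine harmOn_AB (f := fF a y₀) (G := gG a y₀) (strip_open (ℓ / 2)) ?_ ?_ ?_
    · intro z hz
      exact (fF_deriv ha haℓ
        (closed_sub hb1 hb2 z hz.1.le hz.2.le)).differentiableAt.differentiableWithinAt
    · intro z hz
      exact (gG_diff ha haℓ hb1 hb2
        (closed_sub hb1 hb2 z hz.1.le hz.2.le)).differentiableWithinAt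
    · intro z hz
      exact vV_closed ha haℓ hb1 hb2 hz.1.le hz.2.le
  · rw [vV_energy ha haℓ hb1 hb2, ← harg]
    have : a ^ 2 = π ^ 2 / (4 * ℓ ^ 2) := by rw [had]; ring
    rw [this]
    field_simp
    ring
  · have hle : Real.cos (π * y₀ / ℓ) ^ 2 ≤ 1 := by
      have := Real.cos_le_one (π * y₀ / ℓ)
      nlinarith
    have := Real.pi_pos
    apply div_le_div_of_nonneg_left (by positivity) (by positivity)
    have : 0 < ℓ ^ 2 := by positivity
    nlinarith

end
end

section
/- Identify ℝ² with ℂ. Let y₀ < 0 and let Ω = ℝ × (−∞, 0) ⊂ ℂ be the lower half-plane. Define u : ℂ → ℂ by u(z) = 2/(z + iy₀) for Im z < 0 and u(z) = 2/(conj(z) + iy₀) for Im z ≥ 0. Then u is well defined and continuous on ℂ, holomorphic (hence harmonic) on Ω, and ∫_{ℝ²} (|∇Re u|² + |∇Im u|²) dx = 4π/y₀². -/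
open MeasureTheory Real Complex

noncomputable section

/-- The candidate minimizer for the lower half-plane `Ω = ℝ × (−∞, 0)`:
`u(z) = 2/(z + iy₀)` for `Im z < 0` and `2/(conj z + iy₀)` for `Im z ≥ 0`. -/
def halfU (y₀ : ℝ) (z : ℂ) : ℂ :=
  if z.im < 0 then 2 / (z + Complex.I * (y₀ : ℂ))
  else 2 / (starRingEnd ℂ z + Complex.I * (y₀ : ℂ))

lemma aux_halfU_eq (y₀ : ℝ) (z : ℂ) :
    halfU y₀ z = 2 / ((z.re : ℂ) + Complex.I * ((y₀ - |z.im| : ℝ) : ℂ)) := by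
  unfold halfU
  split_ifs with h
  · congr 1
    apply Complex.ext <;> simp [abs_of_neg h]
    ring
  · congr 1
    apply Complex.ext <;> simp [abs_of_nonneg (not_lt.1 h)]
    ring

lemma aux_cont (y₀ : ℝ) (hy : y₀ < 0) : Continuous (halfU y₀) := by
  have : halfU y₀ = fun z => 2 / ((z.re : ℂ) + Complex.I * ((y₀ - |z.im| : ℝ) : ℂ)) :=
    funext (aux_halfU_eq y₀)
  rw [this]
  refine Continuous.div continuous_const ?_ ?_
  · have := Complex.continuous_re
    have := Complex.continuous_im
    fun_prop
  · intro z h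
    have := congrArg Complex.im h
    simp at this
    have := abs_nonneg z.im
    linarith

lemma aux_norm (L : ℂ →L[ℝ] ℝ) (r : ℝ) (hr : 0 < r) (h : ∀ v, |L v| ≤ r * ‖v‖)
    (v : ℂ) (hv : ‖v‖ = r) (hLv : L v = r ^ 2) : ‖L‖ = r := by
  apply le_antisymm
  · exact L.opNorm_le_bound hr.le (fun v => by simpa using h v)
  · have := L.le_opNorm v
    rw [hLv, hv, Real.norm_eq_abs, abs_of_nonneg (by positivity)] at this
    nlinarith

/-- derivative of `u` of the form `v ↦ c * T v`, with `T` a linear isometry equivalence -/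
lemma aux_energy (u : ℂ → ℂ) (z c : ℂ) (hc : c ≠ 0) (T : ℂ ≃ₗᵢ[ℝ] ℂ) (L : ℂ →L[ℝ] ℂ)
    (hL : ∀ v, L v = c * T v) (hu : HasFDerivAt u L z) :
    ‖fderiv ℝ (fun w => (u w).re) z‖ ^ 2 + ‖fderiv ℝ (fun w => (u w).im) z‖ ^ 2
      = 2 * ‖c‖ ^ 2 := by
  have h1 : HasFDerivAt (fun w => (u w).re) (Complex.reCLM.comp L) z :=
    (Complex.reCLM.hasFDerivAt (x := u z)).comp z hu
  have h2 : HasFDerivAt (fun w => (u w).im) (Complex.imCLM.comp L) z :=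
    (Complex.imCLM.hasFDerivAt (x := u z)).comp z hu
  have hc' : 0 < ‖c‖ := norm_pos_iff.2 hc
  rw [h1.fderiv, h2.fderiv]
  have e1 : ‖Complex.reCLM.comp L‖ = ‖c‖ := by
    refine aux_norm _ _ hc' ?_ (T.symm (starRingEnd ℂ c)) (by simp) ?_
    · intro v
      have := Complex.abs_re_le_norm (c * T v)
      rw [norm_mul, T.norm_map] at this
      simpa only [ContinuousLinearMap.comp_apply, hL, Complex.reCLM_apply] using this
    · simp only [ContinuousLinearMap.comp_apply, hL, Complex.reCLM_apply,
        LinearIsometryEquiv.apply_symm_apply, Complex.mul_conj, Complex.ofReal_re,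
        Complex.normSq_eq_norm_sq]
  have e2 : ‖Complex.imCLM.comp L‖ = ‖c‖ := by
    refine aux_norm _ _ hc' ?_ (T.symm (Complex.I * starRingEnd ℂ c)) (by simp) ?_
    · intro v
      have := Complex.abs_im_le_norm (c * T v)
      rw [norm_mul, T.norm_map] at this
      simpa only [ContinuousLinearMap.comp_apply, hL, Complex.imCLM_apply] using this
    · simp only [ContinuousLinearMap.comp_apply, hL, Complex.imCLM_apply,
        LinearIsometryEquiv.apply_symm_apply]
      rw [mul_left_comm, Complex.mul_conj, Complex.normSq_eq_norm_sq]
      simp only [Complex.I_mul_im, Complex.ofReal_re]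
  rw [e1, e2]; ring

lemma aux_deriv (w : ℂ) (a : ℂ) (h : w + a ≠ 0) :
    HasDerivAt (fun z : ℂ => 2 / (z + a)) (-2 / (w + a) ^ 2) w := by
  have := (hasDerivAt_const w (2 : ℂ)).div ((hasDerivAt_id w).add_const a) h
  refine this.congr_deriv ?_
  simp

lemma aux_diffOn (y₀ : ℝ) (hy : y₀ < 0) :
    DifferentiableOn ℂ (halfU y₀) {z : ℂ | z.im < 0} := by
  intro z hz
  have hz' : z.im < 0 := hz
  have h0 : z + Complex.I * (y₀ : ℂ) ≠ 0 := by
    intro h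
    have := congrArg Complex.im h
    simp at this
    linarith
  refine ((aux_deriv z _ h0).differentiableAt.differentiableWithinAt).congr ?_ ?_
  · intro w hw
    have hw' : w.im < 0 := hw
    simp [halfU, hw']
  · simp [halfU, hz']

/-- the a.e. energy density -/
lemma aux_density (y₀ : ℝ) (hy : y₀ < 0) (z : ℂ) (hz : z.im ≠ 0) :
    ‖fderiv ℝ (fun w => (halfU y₀ w).re) z‖ ^ 2 + ‖fderiv ℝ (fun w => (halfU y₀ w).im) z‖ ^ 2
      = 8 * ((z.re ^ 2 + (|z.im| - y₀) ^ 2) ^ 2)⁻¹ := by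
  have key : ∀ s : ℂ, ‖-2 / s ^ 2‖ ^ 2 = 4 * ((s.re ^ 2 + s.im ^ 2) ^ 2)⁻¹ := by
    intro s
    rw [norm_div, norm_pow, Complex.sq_norm, Complex.normSq_apply, div_pow, div_eq_mul_inv]
    norm_num
    ring
  rcases lt_or_gt_of_ne hz with h | h
  · have h0 : z + Complex.I * (y₀ : ℂ) ≠ 0 := by
      intro h
      have := congrArg Complex.im h
      simp at this
      linarith
    have hd := (aux_deriv z _ h0).hasFDerivAt.restrictScalars ℝ
    have hev : halfU y₀ =ᶠ[nhds z] fun z => 2 / (z + Complex.I * (y₀ : ℂ)) := by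
      filter_upwards [(isOpen_lt Complex.continuous_im continuous_const).mem_nhds h] with w hw
      have hw' : w.im < 0 := hw
      simp [halfU, hw']
    rw [aux_energy (halfU y₀) z _ (div_ne_zero (neg_ne_zero.2 two_ne_zero) (pow_ne_zero 2 h0))
      (LinearIsometryEquiv.refl ℝ ℂ) _ (fun v => by simp [mul_comm]) (hd.congr_of_eventuallyEq hev), key]
    simp [abs_of_neg h]
    ring
  · have h0 : (starRingEnd ℂ z) + Complex.I * (y₀ : ℂ) ≠ 0 := by
      intro h
      have := congrArg Complex.im h
      simp at this
      linarith
    have hd := ((aux_deriv _ _ h0).hasFDerivAt.restrictScalars ℝ).comp z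
      (Complex.conjCLE.toContinuousLinearMap.hasFDerivAt (x := z))
    have hev : halfU y₀ =ᶠ[nhds z]
        ((fun z => 2 / (z + Complex.I * (y₀ : ℂ))) ∘ Complex.conjCLE.toContinuousLinearMap) := by
      filter_upwards [(isOpen_lt continuous_const Complex.continuous_im).mem_nhds h] with w hw
      have hw' : 0 < w.im := hw
      simp [halfU, hw'.not_gt]
    rw [aux_energy (halfU y₀) z _ (div_ne_zero (neg_ne_zero.2 two_ne_zero) (pow_ne_zero 2 h0))
      Complex.conjLIE _ (fun v => by simp [mul_comm]) (hd.congr_of_eventuallyEq hev), key]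
    simp [abs_of_pos h]
    ring

open Filter Topology in
lemma aux_inner (t : ℝ) (ht : 0 < t) :
    Integrable (fun x : ℝ => 8 * ((x ^ 2 + t ^ 2) ^ 2)⁻¹) ∧
    ∫ x : ℝ, 8 * ((x ^ 2 + t ^ 2) ^ 2)⁻¹ = 4 * π * (t ^ 3)⁻¹ := by
  have hpos : ∀ x : ℝ, 0 < x ^ 2 + t ^ 2 := fun x => by positivity
  have hint : Integrable (fun x : ℝ => 8 * ((x ^ 2 + t ^ 2) ^ 2)⁻¹) := by
    have h1 : Integrable (fun x : ℝ => (8 / t ^ 4) * (1 + (x / t) ^ 2)⁻¹) :=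
      (integrable_inv_one_add_sq.comp_div ht.ne').const_mul _
    refine h1.mono' ?_ ?_
    · refine Continuous.aestronglyMeasurable ?_
      refine continuous_const.mul (Continuous.inv₀ (by fun_prop) ?_)
      intro x; have := hpos x; positivity
    · refine Eventually.of_forall fun x => ?_
      have := hpos x
      rw [Real.norm_eq_abs, abs_of_nonneg (by positivity)]
      have e : (8 / t ^ 4) * (1 + (x / t) ^ 2)⁻¹ = 8 * ((x ^ 2 + t ^ 2) * t ^ 2)⁻¹ := by
        field_simp
        ring
      rw [e]
      gcongr
      nlinarith [sq_nonneg x]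
  refine ⟨hint, ?_⟩
  have hderiv : ∀ x : ℝ, HasDerivAt
      (fun x : ℝ => 4 * (t ^ 2)⁻¹ * (x / (x ^ 2 + t ^ 2)) + 4 * (t ^ 3)⁻¹ * Real.arctan (x / t))
      (8 * ((x ^ 2 + t ^ 2) ^ 2)⁻¹) x := by
    intro x
    have hx := hpos x
    have a1 := ((hasDerivAt_id x).div (((hasDerivAt_id x).pow 2).add_const (t ^ 2)) hx.ne').const_mul
      (4 * (t ^ 2)⁻¹)
    have a2 := (((hasDerivAt_id x).div_const t).arctan).const_mul (4 * (t ^ 3)⁻¹)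
    refine (a1.add a2).congr_deriv ?_
    simp
    have : (1 + (x / t) ^ 2) = (x ^ 2 + t ^ 2) / t ^ 2 := by field_simp; ring
    rw [this]
    field_simp
    ring
  have hq : ∀ l : Filter ℝ, Tendsto (fun x : ℝ => |x|) l atTop →
      Tendsto (fun x : ℝ => x / (x ^ 2 + t ^ 2)) l (𝓝 0) := by
    intro l hl
    refine squeeze_zero_norm (a := fun x => |x|⁻¹) ?_ (tendsto_inv_atTop_zero.comp hl)
    intro x
    rw [norm_div, Real.norm_eq_abs, Real.norm_eq_abs, abs_of_pos (hpos x)]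
    rcases eq_or_ne x 0 with rfl | hx
    · simp
    have : 0 < |x| := abs_pos.2 hx
    rw [div_le_iff₀ (hpos x), ← sq_abs x]
    field_simp
    nlinarith [sq_nonneg t]
  have htop : Tendsto (fun x : ℝ => 4 * (t ^ 2)⁻¹ * (x / (x ^ 2 + t ^ 2)) + 4 * (t ^ 3)⁻¹ * Real.arctan (x / t))
      atTop (𝓝 (4 * (t ^ 2)⁻¹ * 0 + 4 * (t ^ 3)⁻¹ * (π / 2))) := by
    refine ((hq _ tendsto_abs_atTop_atTop).const_mul _).add (Tendsto.const_mul _ ?_)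
    exact (Real.tendsto_arctan_atTop.mono_right nhdsWithin_le_nhds).comp
      (tendsto_id.atTop_div_const ht)
  have hbot : Tendsto (fun x : ℝ => 4 * (t ^ 2)⁻¹ * (x / (x ^ 2 + t ^ 2)) + 4 * (t ^ 3)⁻¹ * Real.arctan (x / t))
      atBot (𝓝 (4 * (t ^ 2)⁻¹ * 0 + 4 * (t ^ 3)⁻¹ * (-(π / 2)))) := by
    refine ((hq _ tendsto_abs_atBot_atTop).const_mul _).add (Tendsto.const_mul _ ?_)
    exact (Real.tendsto_arctan_atBot.mono_right nhdsWithin_le_nhds).comp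
      (tendsto_id.atBot_div_const ht)
  rw [integral_of_hasDerivAt_of_tendsto hderiv hint hbot htop]
  ring

open Filter Topology in
lemma aux_outer (a : ℝ) (ha : 0 < a) :
    Integrable (fun y : ℝ => 4 * π * ((|y| + a) ^ 3)⁻¹) ∧
    ∫ y : ℝ, 4 * π * ((|y| + a) ^ 3)⁻¹ = 4 * π / a ^ 2 := by
  have hderiv : ∀ x ∈ Set.Ici (0:ℝ), HasDerivAt
      (fun x : ℝ => -(2 * π) * ((x + a) ^ 2)⁻¹) (4 * π * ((x + a) ^ 3)⁻¹) x := by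
    intro x hx
    have hx' : 0 < x + a := add_pos_of_nonneg_of_pos hx ha
    have := ((((hasDerivAt_id x).add_const a).pow 2).inv (pow_ne_zero 2 hx'.ne')).const_mul
      (-(2 * π))
    refine this.congr_deriv ?_
    simp
    field_simp
    ring
  have hnn : ∀ x ∈ Set.Ioi (0:ℝ), 0 ≤ 4 * π * ((x + a) ^ 3)⁻¹ := by
    intro x hx
    have hx' : 0 < x + a := add_pos hx ha
    positivity
  have hlim : Tendsto (fun x : ℝ => -(2 * π) * ((x + a) ^ 2)⁻¹) atTop (𝓝 (-(2 * π) * 0)) := by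
    refine Tendsto.const_mul _ ?_
    refine tendsto_inv_atTop_zero.comp ?_
    exact (tendsto_pow_atTop two_ne_zero).comp (tendsto_atTop_add_const_right _ _ tendsto_id)
  have hV := integral_Ioi_of_hasDerivAt_of_nonneg' hderiv hnn hlim
  have hval : ∫ y : ℝ, 4 * π * ((|y| + a) ^ 3)⁻¹ = 4 * π / a ^ 2 := by
    have := integral_comp_abs (f := fun y : ℝ => 4 * π * ((y + a) ^ 3)⁻¹)
    rw [this, hV]
    field_simp
    ring
  refine ⟨?_, hval⟩
  by_contra hcon
  rw [integral_undef hcon] at hval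
  have : 0 < 4 * π / a ^ 2 := by positivity
  linarith

lemma aux_energy_val (y₀ : ℝ) (hy : y₀ < 0) : dirE (halfU y₀) = 4 * π / y₀ ^ 2 := by
  have hae : ∀ᵐ z : ℂ, z.im ≠ 0 := by
    have h1 : ∀ᵐ p : ℝ × ℝ, p.2 ≠ 0 :=
      Measure.quasiMeasurePreserving_snd.ae (Measure.ae_ne volume (0:ℝ))
    exact Complex.volume_preserving_equiv_real_prod.quasiMeasurePreserving.ae h1
  unfold dirE
  rw [integral_congr_ae (hae.mono fun z hz => aux_density y₀ hy z hz)]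
  have h2 := Complex.volume_preserving_equiv_real_prod.integral_comp
    Complex.measurableEquivRealProd.measurableEmbedding
    (fun p : ℝ × ℝ => 8 * ((p.1 ^ 2 + (|p.2| - y₀) ^ 2) ^ 2)⁻¹)
  have ht : ∀ y : ℝ, 0 < |y| - y₀ := fun y => by have := abs_nonneg y; linarith
  have hout := aux_outer (-y₀) (by linarith)
  have hprod : Integrable (fun p : ℝ × ℝ => 8 * ((p.1 ^ 2 + (|p.2| - y₀) ^ 2) ^ 2)⁻¹)
      (volume.prod volume) := by
    rw [integrable_prod_iff']
    · refine ⟨Filter.Eventually.of_forall fun y => (aux_inner _ (ht y)).1, ?_⟩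
      have : (fun y : ℝ => ∫ x : ℝ, ‖8 * ((x ^ 2 + (|y| - y₀) ^ 2) ^ 2)⁻¹‖) =
          fun y : ℝ => 4 * π * ((|y| + -y₀) ^ 3)⁻¹ := by
        funext y
        rw [← sub_eq_add_neg, ← (aux_inner _ (ht y)).2]
        congr 1
        funext x
        rw [Real.norm_eq_abs, abs_of_nonneg (by positivity)]
      exact this ▸ hout.1
    · refine Continuous.aestronglyMeasurable ?_
      refine continuous_const.mul (Continuous.inv₀ (by fun_prop) ?_)
      intro p
      have := ht p.2
      positivity
  refine h2.trans ?_
  rw [Measure.volume_eq_prod, integral_prod_symm _ hprod]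
  simp only [(aux_inner _ (ht _)).2]
  have := hout.2
  simpa [sub_eq_add_neg] using this

/-- for `y₀ < 0`, the map `halfU y₀` is well defined and continuous
on `ℂ`, holomorphic (hence harmonic) on the lower half-plane, and its Dirichlet
energy is `4π/y₀²`. -/
theorem halfplane_tail_energy (y₀ : ℝ) (hy : y₀ < 0) :
    Continuous (halfU y₀) ∧
    DifferentiableOn ℂ (halfU y₀) {z : ℂ | z.im < 0} ∧
    dirE (halfU y₀) = 4 * π / y₀ ^ 2 :=
  ⟨aux_cont y₀ hy, aux_diffOn y₀ hy, aux_energy_val y₀ hy⟩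

end
end
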